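/- arXiv:2312.00928 — 9 statements merged into one kernel-verified Lean document; each statement's English description precedes it below -/
import Mathlib

section
/- Every cactus graph G satisfies HG(G) ≤ 4; equivalently, the hat guessing game ⟨G, ★5⟩ in which every vertex has hatness 5 is losing. -/
/-- The hat guessing game `⟨G, h⟩` is *winning*: there exists a strategy (one
deterministic guessing function per vertex, depending only on the colors of the
neighboring vertices) such that for every assignment of hat colors at least one
vertex guesses its own color correctly. -/
def HatGame.Winning {V : Type*} (G : SimpleGraph V) (h : V → ℕ) : Prop :=
  ∃ s : ∀ v : V, (∀ u : V, Fin (h u)) → Fin (h v),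
    (∀ (v : V) (c c' : ∀ u : V, Fin (h u)),
        (∀ u : V, G.Adj v u → c u = c' u) → s v c = s v c') ∧
    ∀ c : ∀ u : V, Fin (h u), ∃ v : V, s v c = c v

/-- The hat guessing number of `G`: the largest `q` such that the game on `G`
where every vertex has hatness `q` is winning. -/
noncomputable def HatGame.number {V : Type*} (G : SimpleGraph V) : ℕ :=
  sSup {q : ℕ | HatGame.Winning G (fun _ => q)}

/-- A cactus graph: a connected graph in which every pair of (distinct) cycles
shares at most one vertex. -/
def SimpleGraph.IsCactus {V : Type*} (G : SimpleGraph V) : Prop :=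
  G.Connected ∧
    ∀ (v w : V) (c₁ : G.Walk v v) (c₂ : G.Walk w w), c₁.IsCycle → c₂.IsCycle →
      {e | e ∈ c₁.edges} ≠ {e | e ∈ c₂.edges} →
      ({x | x ∈ c₁.support} ∩ {x | x ∈ c₂.support} : Set V).Subsingleton

namespace HatGame

open Finset Function

/-- A strategy on `G` with five colors is local when every guess depends only on the colors of
the neighbors. -/
def IsLocal {V : Type*} (G : SimpleGraph V) (s : V → (V → Fin 5) → Fin 5) : Prop :=
  ∀ v c c', (∀ u, G.Adj v u → c u = c' u) → s v c = s v c'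

/-- Every local strategy on `G` is defeated by some coloring choosing the color of each vertex
`v` in the list `K v`. -/
def Loses {V : Type*} (G : SimpleGraph V) (K : V → Finset (Fin 5)) : Prop :=
  ∀ s, IsLocal G s → ∃ c : V → Fin 5, (∀ v, c v ∈ K v) ∧ ∀ v, s v c ≠ c v

/-- `G` loses even if the palette of one vertex is shrunk to two colors. -/
def RobustlyLoses {V : Type*} [DecidableEq V] (G : SimpleGraph V) : Prop :=
  ∀ (v : V) (x y : Fin 5), x ≠ y → Loses G (update (fun _ => univ) v {x, y})

/-! ### Gluing two graphs at a vertex -/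

theorem Loses.sup {V : Type*} [DecidableEq V] {G₁ G₂ : SimpleGraph V} {K : V → Finset (Fin 5)}
    {B : Set V} {u : V} (h₁ : Loses G₁ K) (hK : ∀ w ∈ B, w ≠ u → K w = univ)
    (h₂ : ∀ a b, a ≠ b → Loses G₂ (update (fun _ => univ) u {a, b}))
    (hG₁ : ∀ v w, G₁.Adj v w → v ∉ B ∨ v = u) (hG₂ : ∀ v w, G₂.Adj v w → v ∈ B ∨ v = u) :
    Loses (G₁ ⊔ G₂) K := by
  classical
  intro s hs
  have hs₁ : ∀ w, w ∉ B → w ≠ u → ∀ c c' : V → Fin 5,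
      (∀ t, G₁.Adj w t → c t = c' t) → s w c = s w c' := by
    intro w hw hwu c c' h
    refine hs w c c' fun t ht => ?_
    rcases ht with ht | ht
    · exact h t ht
    · exact ((hG₂ _ _ ht).elim hw hwu).elim
  have hs₂ : ∀ w, w ∈ B → w ≠ u → ∀ c c' : V → Fin 5,
      (∀ t, G₂.Adj w t → c t = c' t) → s w c = s w c' := by
    intro w hw hwu c c' h
    refine hs w c c' fun t ht => ?_
    rcases ht with ht | ht
    · exact ((hG₁ _ _ ht).elim (fun h => h hw) hwu).elim
    · exact h t ht
  let E : (V → Fin 5) → Fin 5 → Prop := fun c x =>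
    ∃ d : V → Fin 5, (∀ v, d v ∈ K v) ∧ d u = x ∧ (∀ t, G₁.Adj u t → d t = c t) ∧
      ∀ w, w ∉ B → w ≠ u → s w d ≠ d w
  have hE : ∀ c c' : V → Fin 5, (∀ t, G₁.Adj u t → c t = c' t) → E c = E c' := by
    intro c c' h
    funext x
    apply propext
    constructor
    · rintro ⟨d, h1, h2, h3, h4⟩
      exact ⟨d, h1, h2, fun t ht => (h3 t ht).trans (h t ht), h4⟩
    · rintro ⟨d, h1, h2, h3, h4⟩
      exact ⟨d, h1, h2, fun t ht => (h3 t ht).trans (h t ht).symm, h4⟩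
  let s₁ : V → (V → Fin 5) → Fin 5 := fun w c =>
    if w = u then Classical.epsilon (E c) else if w ∈ B then 0 else s w c
  obtain ⟨d₁, hd₁K, hd₁⟩ := h₁ s₁ (by
    intro v c c' h
    by_cases hv : v = u
    · subst hv
      simp only [s₁, if_true, hE c c' h]
    · by_cases hB : v ∈ B
      · simp [s₁, hv, hB]
      · simpa [s₁, hv, hB] using hs₁ v hB hv c c' h)
  have hd₁' : ∀ w, w ∉ B → w ≠ u → s w d₁ ≠ d₁ w := by
    intro w hB hw
    simpa [s₁, hw, hB] using hd₁ w
  obtain ⟨d₂, hd₂K, hd₂u, hd₂, hd₂'⟩ : E d₁ (Classical.epsilon (E d₁)) :=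
    Classical.epsilon_spec ⟨d₁ u, d₁, hd₁K, rfl, fun _ _ => rfl, hd₁'⟩
  have hne : d₂ u ≠ d₁ u := by
    have := hd₁ u
    simpa [s₁, hd₂u] using this
  let s₂ : V → (V → Fin 5) → Fin 5 := fun w c =>
    if w = u then s u (fun t => if G₁.Adj u t then d₁ t else c t)
    else if w ∈ B then s w c else 0
  obtain ⟨c, hcK, hc⟩ := h₂ (d₁ u) (d₂ u) hne.symm s₂ (by
    intro v c c' h
    by_cases hv : v = u
    · subst hv
      simp only [s₂, if_true]
      refine hs v _ _ fun t ht => ?_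
      by_cases h1 : G₁.Adj v t
      · simp [h1]
      · simpa [h1] using h t (ht.resolve_left h1)
    · by_cases hB : v ∈ B
      · simpa [s₂, hv, hB] using hs₂ v hB hv c c' h
      · simp [s₂, hv, hB])
  have hcu : c u = d₁ u ∨ c u = d₂ u := by simpa using hcK u
  obtain ⟨d, hdK, hdu, hdN, hd⟩ : ∃ d : V → Fin 5, (∀ v, d v ∈ K v) ∧ d u = c u ∧
      (∀ t, G₁.Adj u t → d t = d₁ t) ∧ ∀ w, w ∉ B → w ≠ u → s w d ≠ d w := by
    rcases hcu with h | h
    · exact ⟨d₁, hd₁K, h.symm, fun _ _ => rfl, hd₁'⟩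
    · exact ⟨d₂, hd₂K, h.symm, hd₂, hd₂'⟩
  let e : V → Fin 5 := fun w => if w ∈ B ∧ w ≠ u then c w else d w
  have he₁ : ∀ w, w ∉ B ∨ w = u → e w = d w := by
    intro w hw
    have : ¬ (w ∈ B ∧ w ≠ u) := by tauto
    simp [e, this]
  have he₂ : ∀ w, w ∈ B ∨ w = u → e w = c w := by
    intro w hw
    by_cases h : w = u
    · subst h
      rw [he₁ w (Or.inr rfl), hdu]
    · have : w ∈ B ∧ w ≠ u := by tauto
      simp [e, this]
  refine ⟨e, fun v => ?_, fun v => ?_⟩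
  · by_cases h : v ∈ B ∧ v ≠ u
    · rw [hK v h.1 h.2]
      exact mem_univ _
    · simpa [e, h] using hdK v
  · by_cases hv : v = u
    · subst hv
      have := hc v
      simp only [s₂, if_true] at this
      rw [he₂ v (Or.inr rfl)]
      refine fun h => this (Eq.trans (hs v _ _ fun t ht => ?_) h)
      by_cases h1 : G₁.Adj v t
      · simp only [h1, if_true]
        rw [he₁ t (hG₁ _ _ h1.symm), hdN t h1]
      · simp only [h1, if_false]
        rw [he₂ t (hG₂ _ _ (ht.resolve_left h1).symm)]
    · by_cases hB : v ∈ B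
      · have := hc v
        simp only [s₂, hv, hB, if_true, if_false] at this
        rw [he₂ v (Or.inl hB), hs₂ v hB hv e c fun t ht => he₂ t (hG₂ _ _ ht.symm)]
        exact this
      · rw [he₁ v (Or.inl hB), hs₁ v hB hv e d fun t ht => he₁ t (hG₁ _ _ ht.symm)]
        exact hd v hB hv

/-! ### Counting colors -/

theorem exists_fibers_card_le_one (f g : Fin 5 → Fin 5) :
    ∃ a, #{c | f c = a} ≤ 1 ∧ #{c | g c = a} ≤ 1 := by
  have key : ∀ f : Fin 5 → Fin 5, #{a | ¬ #{c | f c = a} ≤ 1} ≤ 2 := by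
    intro f
    have h : #(univ : Finset (Fin 5)) = ∑ a, #{c | f c = a} :=
      card_eq_sum_card_fiberwise (t := univ) fun _ _ => mem_univ _
    have h2 : ∑ a ∈ {a | ¬ #{c | f c = a} ≤ 1}, 2 ≤ ∑ a, #{c | f c = a} := by
      refine le_trans (sum_le_sum (g := fun a => #{c | f c = a}) fun a ha => ?_)
        (sum_le_sum_of_subset (filter_subset _ _))
      have := (mem_filter.1 ha).2
      lia
    rw [← h] at h2
    simp only [sum_const, smul_eq_mul, card_univ, Fintype.card_fin] at h2
    lia
  by_contra! hcon
  have hsub : (univ : Finset (Fin 5)) ⊆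
      filter (fun a => ¬ #{c | f c = a} ≤ 1) univ ∪ filter (fun a => ¬ #{c | g c = a} ≤ 1) univ := by
    intro a _
    simp only [mem_union, mem_filter, mem_univ, true_and]
    by_contra! h
    exact absurd (hcon a h.1) (by lia)
  have h1 := (card_le_card hsub).trans (card_union_le _ _)
  have h2 := key f
  have h3 := key g
  simp only [card_univ, Fintype.card_fin] at h1
  lia

/-- Given the guessing functions along a path whose first two vertices have colors `z` and `a₁`,
the colors `p` and `c` of the vertices `i` and `i + 1` extend to a coloring of the path for which
the vertices `1, …, i` guess wrong. -/
def PathExtends (g : ℕ → Fin 5 → Fin 5 → Fin 5) (z a₁ : Fin 5) (i : ℕ) (p c : Fin 5) : Prop :=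
  ∃ a : ℕ → Fin 5, a 0 = z ∧ a 1 = a₁ ∧ a i = p ∧ a (i + 1) = c ∧
    ∀ j < i, g j (a j) (a (j + 2)) ≠ a (j + 1)

theorem PathExtends.succ {g : ℕ → Fin 5 → Fin 5 → Fin 5} {z a₁ p b c : Fin 5} {i : ℕ}
    (h : PathExtends g z a₁ i p b) (hc : g i p c ≠ b) : PathExtends g z a₁ (i + 1) b c := by
  obtain ⟨a, h0, h1, hp, hb, h⟩ := h
  refine ⟨update a (i + 2) c, by simpa using h0, by simpa using h1, by simpa using hb,
    by simp, fun j hj => ?_⟩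
  rw [update_of_ne (by lia), update_of_ne (a := j + 1) (by lia)]
  rcases Nat.lt_succ_iff_lt_or_eq.1 hj with h' | rfl
  · rw [update_of_ne (by lia)]
    exact h j h'
  · rw [update_self, hp, hb]
    exact hc

theorem pathExtends_one {g : ℕ → Fin 5 → Fin 5 → Fin 5} {z a₁ c : Fin 5}
    (h : g 0 z c ≠ a₁) : PathExtends g z a₁ 1 a₁ c :=
  ⟨fun k => if k = 0 then z else if k = 1 then a₁ else c, by simp, by simp, by simp, by simp,
    fun j hj => by
      obtain rfl : j = 0 := by lia
      simpa using h⟩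

open Classical in
theorem three_le_card_pathExtends {g : ℕ → Fin 5 → Fin 5 → Fin 5} {z a₁ : Fin 5}
    (h : #{c | g 0 z c = a₁} ≤ 1) {i : ℕ} (hi : 2 ≤ i) (c : Fin 5) :
    3 ≤ #{p | PathExtends g z a₁ i p c} := by
  induction i, hi using Nat.le_induction generalizing c with
  | base =>
    have hsub : (univ : Finset (Fin 5)) ⊆ filter (fun p => PathExtends g z a₁ 2 p c) univ ∪
        (filter (fun c => g 0 z c = a₁) univ ∪ {g 1 a₁ c}) := by
      intro p _
      simp only [mem_union, mem_filter, mem_univ, true_and, mem_singleton]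
      by_contra! hp
      exact hp.1 ((pathExtends_one hp.2.1).succ hp.2.2.symm)
    have h1 := card_le_card hsub
    have h2 := card_union_le (filter (fun p => PathExtends g z a₁ 2 p c) univ)
      (filter (fun c => g 0 z c = a₁) univ ∪ {g 1 a₁ c})
    have h3 := card_union_le (filter (fun c => g 0 z c = a₁) univ) {g 1 a₁ c}
    simp only [card_univ, Fintype.card_fin, card_singleton] at h1 h3
    lia
  | succ i hi ih =>
    have hbad : #{b | ¬ PathExtends g z a₁ (i + 1) b c} ≤ 1 := by
      refine card_le_one.2 fun b hb b' hb' => ?_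
      by_contra hne
      simp only [mem_filter, mem_univ, true_and] at hb hb'
      have hdisj : Disjoint (filter (fun p => PathExtends g z a₁ i p b) univ)
          (filter (fun p => PathExtends g z a₁ i p b') univ) := by
        refine disjoint_left.2 fun p hp hp' => hne ?_
        simp only [mem_filter, mem_univ, true_and] at hp hp'
        rw [← not_ne_iff.1 (mt hp.succ hb), ← not_ne_iff.1 (mt hp'.succ hb')]
      have h1 := card_le_univ ((filter (fun p => PathExtends g z a₁ i p b) univ) ∪
        filter (fun p => PathExtends g z a₁ i p b') univ)
      rw [card_union_of_disjoint hdisj, Fintype.card_fin] at h1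
      have h2 := ih b
      have h3 := ih b'
      lia
    have := card_filter_add_card_filter_not (s := (univ : Finset (Fin 5)))
      (fun b => PathExtends g z a₁ (i + 1) b c)
    rw [card_univ, Fintype.card_fin] at this
    lia

/-- The colors on a cycle `0, 1, …, m`, where `f` and `g` are the guessing functions and the
vertex `0` has two available colors. -/
theorem exists_cycle_coloring {m : ℕ} (hm : 2 ≤ m) (f : Fin 5 → Fin 5 → Fin 5)
    (g : ℕ → Fin 5 → Fin 5 → Fin 5) {x y : Fin 5} (hxy : x ≠ y) :
    ∃ a : ℕ → Fin 5, (a 0 = x ∨ a 0 = y) ∧ f (a 1) (a m) ≠ a 0 ∧ a (m + 1) = a 0 ∧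
      ∀ j < m, g j (a j) (a (j + 2)) ≠ a (j + 1) := by
  classical
  obtain ⟨a₁, hx, hy⟩ := exists_fibers_card_le_one (g 0 x) (g 0 y)
  have h1 := three_le_card_pathExtends (g := g) hx hm x
  have h2 := three_le_card_pathExtends (g := g) hy hm y
  obtain ⟨b, hb⟩ : ((filter (fun p => PathExtends g x a₁ m p x) univ) ∩
      filter (fun p => PathExtends g y a₁ m p y) univ).Nonempty := by
    rw [← card_pos]
    have h3 := card_union_add_card_inter (filter (fun p => PathExtends g x a₁ m p x) univ)
      (filter (fun p => PathExtends g y a₁ m p y) univ)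
    have h4 := card_le_univ (filter (fun p => PathExtends g x a₁ m p x) univ ∪
      filter (fun p => PathExtends g y a₁ m p y) univ)
    rw [Fintype.card_fin] at h4
    lia
  simp only [mem_inter, mem_filter, mem_univ, true_and] at hb
  obtain ⟨⟨a, ha0, ha1, ham, ham', ha⟩, ⟨a', ha0', ha1', ham2, ham2', ha'⟩⟩ := hb
  by_cases h : f a₁ b = x
  · exact ⟨a', Or.inr ha0', by rw [ha1', ham2, ha0', h]; exact hxy, by rw [ham2', ha0'], ha'⟩
  · exact ⟨a, Or.inl ha0, by rw [ha1, ham, ha0]; exact h, by rw [ham', ha0], ha⟩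

/-! ### Cycles and edges -/

theorem exists_mem_ne_of_one_lt_card {S : Finset (Fin 5)} (hS : 1 < #S) (t : Fin 5) :
    ∃ a ∈ S, t ≠ a := by
  obtain ⟨a, ha, h⟩ := exists_mem_ne hS t
  exact ⟨a, ha, h.symm⟩

theorem loses_cycle {V : Type*} [DecidableEq V] {H : SimpleGraph V} {m : ℕ} (hm : 2 ≤ m)
    {q : ℕ → V} (hq : q (m + 1) = q 0) (hinj : ∀ i ≤ m, ∀ j ≤ m, q i = q j → i = j)
    (hH : ∀ v w, H.Adj v w → ∃ i ≤ m, s(q i, q (i + 1)) = s(v, w))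
    {K : V → Finset (Fin 5)} {x y : Fin 5} (hxy : x ≠ y) (hx : x ∈ K (q 0)) (hy : y ∈ K (q 0))
    (hK : ∀ i ≤ m, i ≠ 0 → K (q i) = univ) (hK' : ∀ v, 1 < #(K v)) : Loses H K := by
  classical
  intro s hs
  have hN0 : ∀ w, H.Adj (q 0) w → w = q 1 ∨ w = q m := by
    intro w hw
    obtain ⟨k, hk, h⟩ := hH _ _ hw
    rw [Sym2.eq_iff] at h
    rcases h with ⟨h1, rfl⟩ | ⟨rfl, h2⟩
    · obtain rfl := hinj k hk 0 (by lia) h1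
      exact Or.inl rfl
    · right
      rcases hk.lt_or_eq with h' | rfl
      · have := hinj (k + 1) h' 0 (by lia) h2
        lia
      · rfl
  have hN : ∀ j < m, ∀ w, H.Adj (q (j + 1)) w → w = q j ∨ w = q (j + 2) := by
    intro j hj w hw
    obtain ⟨k, hk, h⟩ := hH _ _ hw
    rw [Sym2.eq_iff] at h
    rcases h with ⟨h1, rfl⟩ | ⟨rfl, h2⟩
    · obtain rfl := hinj k hk (j + 1) (by lia) h1
      exact Or.inr rfl
    · left
      rcases hk.lt_or_eq with h' | rfl
      · have := hinj (k + 1) h' (j + 1) (by lia) h2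
        obtain rfl : k = j := by lia
        rfl
      · have := hinj 0 (by lia) (j + 1) (by lia) (hq.symm.trans h2)
        lia
  choose iso hisoK hiso using fun v => exists_mem_ne_of_one_lt_card (hK' v) (s v fun _ => 0)
  let g : ℕ → Fin 5 → Fin 5 → Fin 5 := fun j α β =>
    s (q (j + 1)) (update (update (fun _ => 0) (q j) α) (q (j + 2)) β)
  let f : Fin 5 → Fin 5 → Fin 5 := fun α β =>
    s (q 0) (update (update (fun _ => 0) (q 1) α) (q m) β)
  obtain ⟨a, ha0, hf, ham, hg⟩ := exists_cycle_coloring hm f g hxy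
  let col : V → Fin 5 := fun w => if h : ∃ i ≤ m, q i = w then a h.choose else iso w
  have hcol : ∀ i ≤ m, col (q i) = a i := by
    intro i hi
    have h : ∃ k ≤ m, q k = q i := ⟨i, hi, rfl⟩
    simp only [col, dif_pos h]
    rw [hinj _ h.choose_spec.1 _ hi h.choose_spec.2]
  have hcol' : ∀ i ≤ m + 1, col (q i) = a i := by
    intro i hi
    rcases hi.lt_or_eq with h | rfl
    · exact hcol i (by lia)
    · rw [hq, ham, hcol 0 (by lia)]
  have hupd : ∀ t₁ t₂ w, w = t₁ ∨ w = t₂ →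
      col w = update (update (fun _ => (0 : Fin 5)) t₁ (col t₁)) t₂ (col t₂) w := by
    intro t₁ t₂ w hw
    by_cases h : w = t₂
    · subst h; simp
    · obtain rfl := hw.resolve_right h
      simp [update_of_ne h]
  refine ⟨col, fun v => ?_, fun v => ?_⟩
  · by_cases h : ∃ i ≤ m, q i = v
    · obtain ⟨i, hi, rfl⟩ := h
      rw [hcol i hi]
      rcases Nat.eq_zero_or_pos i with rfl | h0
      · rcases ha0 with h | h <;> rw [h] <;> assumption
      · rw [hK i hi h0.ne']
        exact mem_univ _
    · simpa [col, h] using hisoK v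
  · by_cases h : ∃ i ≤ m, q i = v
    · obtain ⟨i, hi, rfl⟩ := h
      rw [hcol i hi]
      rcases i with _ | j
      · rw [← hcol 1 (by lia), ← hcol m le_rfl] at hf
        rwa [hs (q 0) col _ fun w hw => hupd (q 1) (q m) w (hN0 w hw)]
      · have := hg j (by lia)
        rw [← hcol' j (by lia), ← hcol' (j + 2) (by lia)] at this
        rwa [hs (q (j + 1)) col _ fun w hw => hupd (q j) (q (j + 2)) w (hN j (by lia) w hw)]
    · have hv : col v = iso v := by simp [col, h]
      rw [hv, hs v col (fun _ => 0) fun w hw => ?_]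
      · exact hiso v
      · obtain ⟨i, hi, hi'⟩ := hH _ _ hw
        rw [Sym2.eq_iff] at hi'
        refine (h ?_).elim
        rcases hi' with ⟨h1, -⟩ | ⟨-, h1⟩
        · exact ⟨i, hi, h1⟩
        · rcases hi.lt_or_eq with h' | rfl
          · exact ⟨i + 1, h', h1⟩
          · exact ⟨0, by lia, hq.symm.trans h1⟩

theorem exists_edge_coloring (f g : Fin 5 → Fin 5) {x y : Fin 5} (hxy : x ≠ y) :
    ∃ a b, (a = x ∨ a = y) ∧ f b ≠ a ∧ g a ≠ b := by
  obtain ⟨b, hb⟩ : ∃ b, b ∉ ({g x, g y} : Finset (Fin 5)) := by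
    by_contra! h
    have h1 := card_le_card (fun b _ => h b : (univ : Finset (Fin 5)) ⊆ {g x, g y})
    have h2 := card_le_two (a := g x) (b := g y)
    rw [card_univ, Fintype.card_fin] at h1
    lia
  simp only [mem_insert, mem_singleton, not_or] at hb
  by_cases h : f b = x
  · exact ⟨y, b, Or.inr rfl, by rw [h]; exact hxy, fun h => hb.2 h.symm⟩
  · exact ⟨x, b, Or.inl rfl, h, fun h => hb.1 h.symm⟩

theorem loses_edge {V : Type*} [DecidableEq V] {H : SimpleGraph V} {u w : V} (huw : u ≠ w)
    (hH : ∀ t t', H.Adj t t' → s(u, w) = s(t, t')) {K : V → Finset (Fin 5)} {x y : Fin 5}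
    (hxy : x ≠ y) (hx : x ∈ K u) (hy : y ∈ K u) (hw : K w = univ) (hK' : ∀ v, 1 < #(K v)) :
    Loses H K := by
  intro s hs
  choose iso hisoK hiso using fun v => exists_mem_ne_of_one_lt_card (hK' v) (s v fun _ => 0)
  obtain ⟨a, b, ha, hf, hg⟩ :=
    exists_edge_coloring (fun b => s u fun _ => b) (fun a => s w fun _ => a) hxy
  refine ⟨update (update iso w b) u a, fun v => ?_, fun v => ?_⟩
  · by_cases h1 : v = u
    · subst h1
      rw [update_self]
      rcases ha with rfl | rfl <;> assumption
    · rw [update_of_ne h1]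
      by_cases h2 : v = w
      · subst h2
        simp [hw]
      · rw [update_of_ne h2]
        exact hisoK v
  · by_cases h1 : v = u
    · subst h1
      rw [update_self, hs v _ (fun _ => b) fun t ht => ?_]
      · exact hf
      · have := hH _ _ ht
        obtain rfl : w = t := by simpa [Sym2.eq_iff, huw.symm] using this
        simp [update_of_ne huw.symm]
    · by_cases h2 : v = w
      · subst h2
        rw [update_of_ne h1, update_self, hs v _ (fun _ => a) fun t ht => ?_]
        · exact hg
        · have := hH _ _ ht
          obtain rfl : u = t := by simpa [Sym2.eq_iff, huw] using this
          simp
      · rw [update_of_ne h1, update_of_ne h2, hs v _ (fun _ => 0) fun t ht => ?_]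
        · exact hiso v
        · have := hH _ _ ht
          rw [Sym2.eq_iff] at this
          grind

theorem one_lt_card_update {V : Type*} [DecidableEq V] {x y : Fin 5} (hxy : x ≠ y) (v w : V) :
    1 < #(update (fun _ => univ) v {x, y} w : Finset (Fin 5)) := by
  by_cases h : w = v
  · subst h
    rw [update_self, card_pair hxy]
    lia
  · rw [update_of_ne h, card_univ, Fintype.card_fin]
    lia

theorem robustlyLoses_bot {V : Type*} [DecidableEq V] : RobustlyLoses (⊥ : SimpleGraph V) := by
  intro v x y hxy s hs
  choose c hcK hc using
    fun w => exists_mem_ne_of_one_lt_card (one_lt_card_update hxy v w) (s w fun _ => 0)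
  exact ⟨c, hcK, fun w => by rw [hs w c (fun _ => 0) fun _ h => h.elim]; exact hc w⟩

theorem robustlyLoses_edge {V : Type*} [DecidableEq V] {H : SimpleGraph V} {u w : V}
    (huw : u ≠ w) (hH : ∀ t t', H.Adj t t' → s(u, w) = s(t, t')) : RobustlyLoses H := by
  intro v x y hxy
  by_cases hv : v = w
  · subst hv
    exact loses_edge huw.symm (fun t t' h => Sym2.eq_swap.trans (hH t t' h)) hxy (by simp)
      (by simp) (update_of_ne huw _ _) (one_lt_card_update hxy v)
  · by_cases hu : v = u
    · subst hu
      exact loses_edge huw hH hxy (by simp) (by simp) (update_of_ne huw.symm _ _)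
        (one_lt_card_update hxy v)
    · have h01 : (0 : Fin 5) ≠ 1 := by decide
      exact loses_edge huw hH h01 (by simp [update_of_ne (Ne.symm hu)])
        (by simp [update_of_ne (Ne.symm hu)]) (update_of_ne (Ne.symm hv) _ _)
        (one_lt_card_update hxy v)

theorem loses_isCycle {V : Type*} [DecidableEq V] {G : SimpleGraph V} {u : V} {C : G.Walk u u}
    (hC : C.IsCycle) {K : V → Finset (Fin 5)} {x y : Fin 5} (hxy : x ≠ y) (hx : x ∈ K u)
    (hy : y ∈ K u) (hK : ∀ w ∈ C.support, w ≠ u → K w = univ) (hK' : ∀ v, 1 < #(K v)) :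
    Loses C.toSubgraph.spanningCoe K := by
  have h3 := hC.three_le_length
  have hinj : ∀ i ≤ C.length - 1, ∀ j ≤ C.length - 1, C.getVert i = C.getVert j → i = j :=
    fun i hi j hj h => hC.getVert_injOn' hi hj h
  refine loses_cycle (m := C.length - 1) (q := C.getVert) (by lia) ?_ hinj ?_ hxy (by simpa using hx)
    (by simpa using hy) ?_ hK'
  · rw [Nat.sub_add_cancel (by lia), C.getVert_length, C.getVert_zero]
  · intro v w h
    rw [SimpleGraph.Subgraph.spanningCoe_adj, SimpleGraph.Walk.toSubgraph_adj_iff] at h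
    obtain ⟨i, hi, hlt⟩ := h
    exact ⟨i, by lia, hi⟩
  · intro i hi h0
    refine hK _ (C.getVert_mem_support i) fun h => h0 (hinj i hi 0 (by lia) ?_)
    rw [h, C.getVert_zero]

theorem robustlyLoses_isCycle {V : Type*} [DecidableEq V] {G : SimpleGraph V} {u : V}
    {C : G.Walk u u} (hC : C.IsCycle) : RobustlyLoses C.toSubgraph.spanningCoe := by
  intro v x y hxy
  by_cases hv : v ∈ C.support
  · rw [← C.toSubgraph_rotate hv]
    exact loses_isCycle (hC.rotate hv) hxy (by simp) (by simp)
      (fun w _ hw => update_of_ne hw _ _) (one_lt_card_update hxy v)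
  · have h01 : (0 : Fin 5) ≠ 1 := by decide
    have hu : u ≠ v := fun h => hv (h ▸ C.start_mem_support)
    exact loses_isCycle hC h01 (by simp [update_of_ne hu]) (by simp [update_of_ne hu])
      (fun w hw _ => update_of_ne (ne_of_mem_of_not_mem hw hv) _ _) (one_lt_card_update hxy v)

/-! ### Decomposing a cactus -/

theorem robustlyLoses_of_subgraph {V : Type*} [DecidableEq V] {G H : SimpleGraph V} (hHG : H ≤ G)
    (hH : H ≠ ⊥) (hHl : RobustlyLoses H)
    (hsep : ∀ p ∈ H.support, ∀ q ∈ H.support, (G \ H).Reachable p q → p = q)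
    (ih : ∀ G' < G, RobustlyLoses G') : RobustlyLoses G := by
  by_cases hGH : G \ H = ⊥
  · rwa [le_antisymm (sdiff_eq_bot_iff.1 hGH) hHG]
  obtain ⟨e, f, hef⟩ := SimpleGraph.ne_bot_iff_exists_adj.1 hGH
  obtain ⟨e', f', hef'⟩ := SimpleGraph.ne_bot_iff_exists_adj.1 hH
  let B : Set V := {t | (G \ H).Reachable e t}
  let T : SimpleGraph V :=
    { Adj := fun a b => (G \ H).Adj a b ∧ a ∈ B
      symm := ⟨fun a b h => ⟨h.1.symm, SimpleGraph.Reachable.trans h.2 h.1.reachable⟩⟩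
      loopless := ⟨fun a h => h.1.ne rfl⟩ }
  obtain ⟨u, hu⟩ : ∃ u, ∀ p ∈ H.support, p ∈ B → p = u := by
    by_cases h : ∃ u ∈ H.support, u ∈ B
    · obtain ⟨u, hu, huB⟩ := h
      exact ⟨u, fun p hp hpB => hsep p hp u hu (SimpleGraph.Reachable.trans hpB.symm huB)⟩
    · exact ⟨e, fun p hp hpB => (h ⟨p, hp, hpB⟩).elim⟩
  have hTG : T ≤ G := fun a b h => h.1.1
  have hT : T < G := by
    refine lt_of_le_of_ne hTG fun h => ?_
    have : T.Adj e' f' := h ▸ hHG hef'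
    exact this.1.2 hef'
  have hR : G \ T < G := by
    refine lt_of_le_of_ne sdiff_le fun h => ?_
    have : (G \ T).Adj e f := h.symm ▸ hef.1
    exact this.2 ⟨hef, SimpleGraph.Reachable.refl _⟩
  have hRB : ∀ v w, (G \ T).Adj v w → v ∉ B ∨ v = u := by
    intro v w h
    by_cases hv : v ∈ B
    · by_cases hvw : H.Adj v w
      · exact Or.inr (hu v ⟨w, hvw⟩ hv)
      · exact (h.2 ⟨⟨h.1, hvw⟩, hv⟩).elim
    · exact Or.inl hv
  intro v x y hxy
  by_cases hv : v ∈ B ∧ v ≠ u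
  · rw [← sup_sdiff_cancel_right hTG]
    exact (ih T hT v x y hxy).sup (B := Bᶜ) (u := u)
      (fun w hw _ => update_of_ne (ne_of_mem_of_not_mem hv.1 hw).symm _ _) (ih _ hR u)
      (fun a b h => Or.inl fun h' => h' h.2) hRB
  · rw [← sdiff_sup_cancel hTG]
    exact (ih _ hR v x y hxy).sup (B := B) (u := u)
      (fun w hw hwu => update_of_ne (by rintro rfl; exact hv ⟨hw, hwu⟩) _ _) (ih T hT u)
      hRB (fun a b h => Or.inl h.2)

/-- Distinct cycles share at most one vertex. -/
def CyclesAlmostDisjoint {V : Type*} (G : SimpleGraph V) : Prop :=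
  ∀ (v w : V) (c₁ : G.Walk v v) (c₂ : G.Walk w w), c₁.IsCycle → c₂.IsCycle →
    {e | e ∈ c₁.edges} ≠ {e | e ∈ c₂.edges} →
    ({x | x ∈ c₁.support} ∩ {x | x ∈ c₂.support} : Set V).Subsingleton

theorem CyclesAlmostDisjoint.mono {V : Type*} {G G' : SimpleGraph V} (hle : G' ≤ G)
    (hG : CyclesAlmostDisjoint G) : CyclesAlmostDisjoint G' := by
  intro v w c₁ c₂ h₁ h₂ hne
  have := hG v w (c₁.mapLe hle) (c₂.mapLe hle) (h₁.mapLe hle) (h₂.mapLe hle) (by simpa using hne)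
  simpa using this

theorem eq_of_reachable_sdiff_cycle {V : Type*} [DecidableEq V] {G : SimpleGraph V}
    (hG : CyclesAlmostDisjoint G) {u : V} {C : G.Walk u u} (hC : C.IsCycle) (n : ℕ) :
    ∀ p ∈ C.support, ∀ q ∈ C.support,
      ∀ P : (G \ C.toSubgraph.spanningCoe).Walk p q, P.length = n → p = q := by
  induction n using Nat.strong_induction_on with
  | _ n ih =>
    intro p hp q hq P hPn
    by_contra hpq
    have hbypass : P.bypass.length = n := by
      rcases (P.length_bypass_le_length.trans_eq hPn).lt_or_eq with h | h
      · exact (hpq (ih _ h p hp q hq P.bypass rfl)).elim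
      · exact h
    have hPath : P.bypass.IsPath := P.bypass_isPath
    generalize P.bypass = P at hbypass hPath
    have hint_mem : ∀ r ∈ P.support, r ∈ C.support → r = p ∨ r = q := by
      intro r hrP hrC
      by_contra! h
      refine h.1 (ih _ ?_ p hp r hrC (P.takeUntil r hrP) rfl).symm
      rw [← hbypass]
      exact SimpleGraph.Walk.length_takeUntil_lt_length hrP h.2
    have hPe : ∀ e ∈ P.edges, e ∉ C.edges := by
      intro e he heC
      induction e with
      | _ a b =>
        have := P.adj_of_mem_edges he
        exact this.2 (SimpleGraph.Walk.adj_toSubgraph_iff_mem_edges.2 heC)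
    have hqp : p ∈ (C.rotate q hq).support := by
      rwa [SimpleGraph.Walk.mem_support_rotate_iff]
    let A := (C.rotate q hq).takeUntil p hqp
    have hA : A.IsPath := (hC.rotate hq).isPath_takeUntil hqp
    have hAe : ∀ e ∈ A.edges, e ∈ C.edges := fun e he =>
      (C.rotate_edges q hq).mem_iff.1 ((C.rotate q hq).edges_takeUntil_subset_edges hqp he)
    have hAs : ∀ r ∈ A.support, r ∈ C.support := fun r hr =>
      (C.mem_support_rotate_iff q hq).1 ((C.rotate q hq).support_takeUntil_subset_support hqp hr)
    let P' : G.Walk p q := P.mapLe sdiff_le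
    have hP' : P'.IsPath := hPath.mapLe sdiff_le
    have hP's : P'.support = P.support := by simp [P']
    have hP'e : P'.edges = P.edges := by simp [P']
    have hP'0 : P'.length ≠ 0 := fun h => hpq (SimpleGraph.Walk.eq_of_length_eq_zero h)
    obtain ⟨e, he⟩ : ∃ e, e ∈ P'.edges := by
      refine List.exists_mem_of_length_pos ?_
      rw [SimpleGraph.Walk.length_edges]
      lia
    have hcyc : (P'.append A).IsCycle := by
      refine hP'.isCycle_append hA ?_ ?_
      · intro r hr hr'
        have h1 := P'.cons_tail_support.symm ▸ hP'.support_nodup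
        have h2 := A.cons_tail_support.symm ▸ hA.support_nodup
        rw [List.nodup_cons] at h1 h2
        rcases hint_mem r (hP's ▸ List.mem_of_mem_tail hr) (hAs r (List.mem_of_mem_tail hr'))
          with rfl | rfl
        · exact h1.1 hr
        · exact h2.1 hr'
      · by_contra! h
        have hA' : P' = A.reverse :=
          SimpleGraph.Walk.eq_of_length_le_one h.1 (by simpa using h.2)
        refine hPe e (hP'e ▸ he) (hAe e ?_)
        rw [hA'] at he
        simpa using he
    refine hpq (hG _ _ C (P'.append A) hC hcyc (fun h => ?_) ⟨hp, ?_⟩ ⟨hq, ?_⟩)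
    · have : e ∈ {e | e ∈ C.edges} := by
        rw [h]
        simp [he]
      exact hPe e (hP'e ▸ he) this
    · simp
    · simp

theorem CyclesAlmostDisjoint.robustlyLoses {V : Type*} [Finite V] [DecidableEq V]
    {G : SimpleGraph V} (hG : CyclesAlmostDisjoint G) : RobustlyLoses G := by
  induction G using WellFoundedLT.induction with
  | _ G ih =>
    have ih' : ∀ G' < G, RobustlyLoses G' := fun G' h => ih G' h (hG.mono h.le)
    by_cases hbot : G = ⊥
    · rw [hbot]
      exact robustlyLoses_bot
    by_cases hac : G.IsAcyclic
    · obtain ⟨u, w, huw⟩ := SimpleGraph.ne_bot_iff_exists_adj.1 hbot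
      have hbr := SimpleGraph.isAcyclic_iff_forall_adj_isBridge.1 hac huw
      rw [SimpleGraph.isBridge_iff] at hbr
      have hadj : ∀ a b, (SimpleGraph.fromEdgeSet {s(u, w)}).Adj a b → s(u, w) = s(a, b) :=
        fun a b h => h.1.symm
      have hsupp : ∀ a ∈ (SimpleGraph.fromEdgeSet {s(u, w)}).support, a = u ∨ a = w := by
        rintro a ⟨b, h⟩
        have := hadj a b h
        rw [Sym2.eq_iff] at this
        rcases this with ⟨h, -⟩ | ⟨-, h⟩
        · exact Or.inl h.symm
        · exact Or.inr h.symm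
      refine robustlyLoses_of_subgraph (H := SimpleGraph.fromEdgeSet {s(u, w)}) ?_ ?_
        (robustlyLoses_edge huw.ne hadj) ?_ ih'
      · intro a b h
        have : s(a, b) ∈ G.edgeSet := hadj a b h ▸ huw
        exact this
      · exact SimpleGraph.ne_bot_iff_exists_adj.2 ⟨u, w, by simp [huw.ne]⟩
      · intro p hp q hq h
        have hr : (G.deleteEdges {s(u, w)}).Reachable p q := h
        rcases hsupp p hp with rfl | rfl <;> rcases hsupp q hq with rfl | rfl
        · rfl
        · exact (hbr hr).elim
        · exact (hbr hr.symm).elim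
        · rfl
    · simp only [SimpleGraph.IsAcyclic, not_forall, not_not] at hac
      obtain ⟨u, C, hC⟩ := hac
      have hsupp : ∀ a ∈ C.toSubgraph.spanningCoe.support, a ∈ C.support := by
        rintro a ⟨b, h⟩
        exact SimpleGraph.Walk.mem_support_of_adj_toSubgraph h
      refine robustlyLoses_of_subgraph (H := C.toSubgraph.spanningCoe)
        C.toSubgraph.spanningCoe_le ?_ (robustlyLoses_isCycle hC) ?_ ih'
      · refine SimpleGraph.ne_bot_iff_exists_adj.2 ⟨C.getVert 0, C.getVert 1, ?_⟩
        rw [SimpleGraph.Subgraph.spanningCoe_adj, SimpleGraph.Walk.toSubgraph_adj_iff]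
        exact ⟨0, rfl, by have := hC.three_le_length; lia⟩
      · rintro p hp q hq ⟨P⟩
        exact eq_of_reachable_sdiff_cycle hG hC _ p (hsupp p hp) q (hsupp q hq) P rfl

theorem not_winning_of_robustlyLoses {V : Type*} [DecidableEq V] [Nonempty V] {G : SimpleGraph V}
    (hG : RobustlyLoses G) {n : ℕ} (hn : 5 ≤ n) : ¬ Winning G (fun _ => n) := by
  rintro ⟨s, hs, hwin⟩
  obtain ⟨v₀⟩ := ‹Nonempty V›
  let s' : V → (V → Fin 5) → Fin 5 := fun v c =>
    if h : (s v fun u => (c u).castLE hn).1 < 5 then ⟨_, h⟩ else 0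
  obtain ⟨c, -, hc⟩ := hG v₀ 0 1 (by decide) s' (by
    intro v c c' h
    have : (s v fun u => (c u).castLE hn) = s v fun u => (c' u).castLE hn :=
      hs v _ _ fun u hu => by rw [h u hu]
    simp only [s', this])
  obtain ⟨v, hv⟩ := hwin fun u => (c u).castLE hn
  refine hc v ?_
  have hlt : (s v fun u => (c u).castLE hn).1 < 5 := by
    rw [hv]
    exact (c v).2
  simp only [s', dif_pos hlt]
  ext
  simp [hv]

end HatGame

/-- Every cactus graph has hat guessing number at most 4; equivalently, the game
in which every vertex has hatness 5 is losing. -/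
theorem cactus_hgNumber_le_four {V : Type*} [Fintype V] (G : SimpleGraph V)
    (hG : G.IsCactus) :
    HatGame.number G ≤ 4 ∧ ¬ HatGame.Winning G (fun _ => 5) := by
  classical
  have := hG.1.nonempty
  have hlose : ∀ {n : ℕ}, 5 ≤ n → ¬ HatGame.Winning G (fun _ => n) := fun hn =>
    HatGame.not_winning_of_robustlyLoses
      (HatGame.CyclesAlmostDisjoint.robustlyLoses (G := G) hG.2) hn
  refine ⟨csSup_le' fun q hq => ?_, hlose le_rfl⟩
  by_contra! h
  exact hlose h hq
end

section
/- Let G₁ and G₂ be graphs with vertices v₁ ∈ G₁ and v₂ ∈ G₂, and let G = G₁ +_{v₁,v₂} G₂ be the graph obtained by gluing G₁ and G₂ at v₁ and v₂. Let h₁ and h₂ be hatness functions for G₁ and G₂ respectively, and suppose that ⟨G₁,h₁⟩ and ⟨G₂,h₂⟩ are both winning. Define h on G by h(v) = h₁(v) for v ∈ G₁ ∖ {v₁}, h(v) = h₂(v) for v ∈ G₂ ∖ {v₂}, and h(v) = h₁(v₁)·h₂(v₂) for the glued vertex v = v₁ = v₂. Then ⟨G,h⟩ is winning. -/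
/-- The graph `G₁ +_{v₁,v₂} G₂` obtained by gluing `G₁` and `G₂` at `v₁` and
`v₂`: the disjoint union of `G₁` and `G₂` with `v₁` and `v₂` identified into a
single vertex (represented by `Sum.inl v₁`) whose neighborhood is the union of
the neighborhoods of `v₁` in `G₁` and of `v₂` in `G₂`. -/
def SimpleGraph.glue {V₁ V₂ : Type*} (G₁ : SimpleGraph V₁) (G₂ : SimpleGraph V₂)
    (v₁ : V₁) (v₂ : V₂) : SimpleGraph (V₁ ⊕ {y : V₂ // y ≠ v₂}) :=
  SimpleGraph.fromRel (fun a b =>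
    match a, b with
    | Sum.inl x, Sum.inl x' => G₁.Adj x x'
    | Sum.inl x, Sum.inr y => x = v₁ ∧ G₂.Adj v₂ y.val
    | Sum.inr y, Sum.inl x => x = v₁ ∧ G₂.Adj y.val v₂
    | Sum.inr y, Sum.inr y' => G₂.Adj y.val y'.val)

namespace SimpleGraph

variable {V₁ V₂ : Type*} {G₁ : SimpleGraph V₁} {G₂ : SimpleGraph V₂} {v₁ : V₁} {v₂ : V₂}

theorem glue_adj_inl_inl {x x' : V₁} (h : G₁.Adj x x') :
    (G₁.glue G₂ v₁ v₂).Adj (Sum.inl x) (Sum.inl x') := by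
  simp [glue, h, h.ne]

theorem glue_adj_inl_inr {y : {y : V₂ // y ≠ v₂}} (h : G₂.Adj v₂ y) :
    (G₁.glue G₂ v₁ v₂).Adj (Sum.inl v₁) (Sum.inr y) := by
  simp [glue, h]

theorem glue_adj_inr_inr {y y' : {y : V₂ // y ≠ v₂}} (h : G₂.Adj y y') :
    (G₁.glue G₂ v₁ v₂).Adj (Sum.inr y) (Sum.inr y') := by
  simp [glue, h, Subtype.ext_iff, h.ne]

end SimpleGraph

namespace HatGame

open scoped Classical in
/-- Gluing two winning games, for any hatness function on the glued graph whose color sets are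
identified with those of the two games, the glued vertex carrying a pair of colors. -/
theorem Winning.glue {V₁ V₂ : Type*} {G₁ : SimpleGraph V₁} {G₂ : SimpleGraph V₂}
    {v₁ : V₁} {v₂ : V₂} {h₁ : V₁ → ℕ} {h₂ : V₂ → ℕ}
    (hw₁ : Winning G₁ h₁) (hw₂ : Winning G₂ h₂) (h : V₁ ⊕ {y : V₂ // y ≠ v₂} → ℕ)
    (e : Fin (h (Sum.inl v₁)) ≃ Fin (h₁ v₁) × Fin (h₂ v₂))
    (f : ∀ x, x ≠ v₁ → Fin (h (Sum.inl x)) ≃ Fin (h₁ x))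
    (g : ∀ y, Fin (h (Sum.inr y)) ≃ Fin (h₂ y.val)) :
    Winning (G₁.glue G₂ v₁ v₂) h := by
  obtain ⟨s₁, hs₁, hc₁⟩ := hw₁
  obtain ⟨s₂, hs₂, hc₂⟩ := hw₂
  -- The coloring of each part read off from a coloring of the glued graph.
  obtain ⟨p, hp, hp'⟩ : ∃ p : (∀ a, Fin (h a)) → ∀ x, Fin (h₁ x),
      (∀ c, p c v₁ = (e (c (Sum.inl v₁))).1) ∧
      ∀ c x (hx : x ≠ v₁), p c x = f x hx (c (Sum.inl x)) :=
    ⟨fun c x => if hx : x = v₁ then hx ▸ (e (c (Sum.inl v₁))).1 else f x hx (c (Sum.inl x)),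
      fun c => by simp, fun c x hx => by simp [hx]⟩
  obtain ⟨q, hq, hq'⟩ : ∃ q : (∀ a, Fin (h a)) → ∀ y, Fin (h₂ y),
      (∀ c, q c v₂ = (e (c (Sum.inl v₁))).2) ∧
      ∀ c (y : {y : V₂ // y ≠ v₂}), q c y = g y (c (Sum.inr y)) :=
    ⟨fun c y => if hy : y = v₂ then hy ▸ (e (c (Sum.inl v₁))).2 else
        g ⟨y, hy⟩ (c (Sum.inr ⟨y, hy⟩)),
      fun c => by simp, fun c y => by simp [y.2]⟩
  obtain ⟨s, hsv, hsl, hsr⟩ : ∃ s : ∀ a, (∀ b, Fin (h b)) → Fin (h a),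
      (∀ c, s (Sum.inl v₁) c = e.symm (s₁ v₁ (p c), s₂ v₂ (q c))) ∧
      (∀ c x (hx : x ≠ v₁), s (Sum.inl x) c = (f x hx).symm (s₁ x (p c))) ∧
      ∀ c y, s (Sum.inr y) c = (g y).symm (s₂ y (q c)) :=
    ⟨fun a c => match a with
      | Sum.inl x => if hx : x = v₁ then hx ▸ e.symm (s₁ v₁ (p c), s₂ v₂ (q c))
          else (f x hx).symm (s₁ x (p c))
      | Sum.inr y => (g y).symm (s₂ y (q c)),
      fun c => by simp, fun c x hx => by simp [hx], fun c y => rfl⟩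
  have hps : ∀ (x : V₁) (c c' : ∀ a, Fin (h a)),
      (∀ b, (G₁.glue G₂ v₁ v₂).Adj (Sum.inl x) b → c b = c' b) →
      s₁ x (p c) = s₁ x (p c') := by
    intro x c c' hcc
    refine hs₁ x _ _ fun u hu => ?_
    have hcu := hcc _ (SimpleGraph.glue_adj_inl_inl hu)
    by_cases huv : u = v₁
    · subst huv
      rw [hp, hp, hcu]
    · rw [hp' c u huv, hp' c' u huv, hcu]
  refine ⟨s, ?_, fun c => ?_⟩
  · rintro (x | y) c c' hcc
    · by_cases hx : x = v₁
      · subst hx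
        have hqs : s₂ v₂ (q c) = s₂ v₂ (q c') := by
          refine hs₂ v₂ _ _ fun u hu => ?_
          rw [hq' c ⟨u, hu.ne'⟩, hq' c' ⟨u, hu.ne'⟩,
            hcc _ (SimpleGraph.glue_adj_inl_inr (y := ⟨u, hu.ne'⟩) hu)]
        rw [hsv, hsv, hps x c c' hcc, hqs]
      · rw [hsl c x hx, hsl c' x hx, hps x c c' hcc]
    · rw [hsr, hsr]
      congr 1
      refine hs₂ y _ _ fun u hu => ?_
      by_cases huv : u = v₂
      · subst huv
        rw [hq, hq, hcc _ (SimpleGraph.glue_adj_inl_inr hu.symm).symm]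
      · rw [hq' c ⟨u, huv⟩, hq' c' ⟨u, huv⟩,
          hcc _ (SimpleGraph.glue_adj_inr_inr (y' := ⟨u, huv⟩) hu)]
  · obtain ⟨x, hx⟩ := hc₁ (p c)
    obtain ⟨y, hy⟩ := hc₂ (q c)
    by_cases hxv : x = v₁
    · subst hxv
      by_cases hyv : y = v₂
      · subst hyv
        exact ⟨Sum.inl x, by rw [hsv, hx, hy, hp, hq, Prod.mk.eta, Equiv.symm_apply_apply]⟩
      · exact ⟨Sum.inr ⟨y, hyv⟩, by
          rw [hsr, Equiv.symm_apply_eq, ← hq' c ⟨y, hyv⟩]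
          exact hy⟩
    · exact ⟨Sum.inl x, by rw [hsl c x hxv, hx, hp' c x hxv, Equiv.symm_apply_apply]⟩

end HatGame


/-- Gluing two winning games: if `⟨G₁,h₁⟩` and `⟨G₂,h₂⟩` are winning, then the
game on `G₁ +_{v₁,v₂} G₂` is winning, where the glued vertex gets hatness
`h₁ v₁ * h₂ v₂` and every other vertex keeps its original hatness. -/
theorem glue_winning {V₁ V₂ : Type*} [Fintype V₁] [Fintype V₂] [DecidableEq V₁]
    (G₁ : SimpleGraph V₁) (G₂ : SimpleGraph V₂) (v₁ : V₁) (v₂ : V₂)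
    (h₁ : V₁ → ℕ) (h₂ : V₂ → ℕ) (hh₁ : ∀ v, 1 ≤ h₁ v) (hh₂ : ∀ v, 1 ≤ h₂ v)
    (hw₁ : HatGame.Winning G₁ h₁) (hw₂ : HatGame.Winning G₂ h₂) :
    HatGame.Winning (G₁.glue G₂ v₁ v₂)
      (fun a => match a with
        | Sum.inl x => if x = v₁ then h₁ v₁ * h₂ v₂ else h₁ x
        | Sum.inr y => h₂ y.val) := by
  exact hw₁.glue hw₂ _ ((finCongr (if_pos rfl)).trans finProdFinEquiv.symm)
    (fun _ hx => finCongr (if_neg hx)) (fun _ => Equiv.refl _)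
end

section
/- Let G₁ and G₂ be graphs with vertices v₁ ∈ G₁ and v₂ ∈ G₂, and let G = G₁ +_{v₁,v₂} G₂ be the graph obtained by gluing G₁ and G₂ at v₁ and v₂. Let h₁ and h₂ be hatness functions for G₁ and G₂ respectively, and suppose that ⟨G₁,h₁⟩ and ⟨G₂,h₂⟩ are both losing, with h₁(v₁) ≥ h₂(v₂) = 2. Define h on G by h(v) = h₁(v) for v ∈ G₁ (including the glued vertex, which gets hatness h₁(v₁)) and h(v) = h₂(v) for v ∈ G₂ ∖ {v₂}. Then ⟨G,h⟩ is losing. -/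
/-- In a losing game, for every strategy that is local away from `v`, there are two colorings that
differ at `v`, agree on the neighbors of `v`, and on which every vertex other than `v` guesses
wrongly. -/
theorem HatGame.exists_pair_of_not_winning {V : Type*} {G : SimpleGraph V} {h : V → ℕ}
    (hl : ¬ HatGame.Winning G h) (v : V) (hv : 0 < h v)
    (s : ∀ v : V, (∀ u : V, Fin (h u)) → Fin (h v))
    (hs : ∀ w ≠ v, ∀ c c' : ∀ u : V, Fin (h u),
      (∀ u : V, G.Adj w u → c u = c' u) → s w c = s w c') :
    ∃ c c' : ∀ u : V, Fin (h u), c v ≠ c' v ∧ (∀ u, G.Adj v u → c u = c' u) ∧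
      (∀ w ≠ v, s w c ≠ c w) ∧ ∀ w ≠ v, s w c' ≠ c' w := by
  classical
  by_contra! hcon
  let P : (∀ u : V, Fin (h u)) → (∀ u : V, Fin (h u)) → Prop := fun c c' =>
    (∀ u, G.Adj v u → c u = c' u) ∧ ∀ w ≠ v, s w c' ≠ c' w
  let pick : ((∀ u : V, Fin (h u)) → Prop) → Fin (h v) := fun Q =>
    if hc : ∃ c', Q c' then hc.choose v else ⟨0, hv⟩
  refine hl ⟨Function.update s v fun c => pick (P c), fun w c c' hcc => ?_, fun c => ?_⟩
  · rcases eq_or_ne w v with rfl | hw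
    · have hP : P c = P c' := by
        funext d
        refine propext (and_congr_left fun _ => forall₂_congr fun u hu => ?_)
        rw [hcc u hu]
      simp only [Function.update_self, hP]
    · simpa only [Function.update_of_ne hw] using hs w hw c c' hcc
  · by_cases hw : ∃ w ≠ v, s w c = c w
    · obtain ⟨w, hwv, hw⟩ := hw
      exact ⟨w, by rwa [Function.update_of_ne hwv]⟩
    · push Not at hw
      have hc : ∃ c', P c c' := ⟨c, fun _ _ => rfl, hw⟩
      refine ⟨v, ?_⟩
      simp only [Function.update_self, pick, dif_pos hc]
      by_contra hne
      obtain ⟨w, hwv, hw'⟩ := hcon c _ (Ne.symm hne) hc.choose_spec.1 hw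
      exact hc.choose_spec.2 w hwv hw'

/-- Gluing two losing games: if `⟨G₁,h₁⟩` and `⟨G₂,h₂⟩` are losing with
`h₁ v₁ ≥ h₂ v₂ = 2`, then the game on `G₁ +_{v₁,v₂} G₂` is losing, where the
glued vertex gets hatness `h₁ v₁` and every other vertex keeps its original
hatness. -/
theorem glue_losing {V₁ V₂ : Type*} [Fintype V₁] [Fintype V₂]
    (G₁ : SimpleGraph V₁) (G₂ : SimpleGraph V₂) (v₁ : V₁) (v₂ : V₂)
    (h₁ : V₁ → ℕ) (h₂ : V₂ → ℕ) (hh₁ : ∀ v, 1 ≤ h₁ v) (hh₂ : ∀ v, 1 ≤ h₂ v)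
    (hv₂ : h₂ v₂ = 2) (hv₁ : 2 ≤ h₁ v₁)
    (hl₁ : ¬ HatGame.Winning G₁ h₁) (hl₂ : ¬ HatGame.Winning G₂ h₂) :
    ¬ HatGame.Winning (G₁.glue G₂ v₁ v₂)
      (fun a => match a with
        | Sum.inl x => h₁ x
        | Sum.inr y => h₂ y.val) := by
  classical
  rintro ⟨s, hloc, hwin⟩
  let combine : (∀ x, Fin (h₁ x)) → (∀ y, Fin (h₂ y)) →
      ∀ a : V₁ ⊕ {y : V₂ // y ≠ v₂}, Fin (match a with
        | Sum.inl x => h₁ x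
        | Sum.inr y => h₂ y.val) := fun c d a => match a with
    | Sum.inl x => c x
    | Sum.inr y => d y.val
  have hleft : ∀ x ≠ v₁, ∀ c c' : ∀ x, Fin (h₁ x), ∀ d d' : ∀ y, Fin (h₂ y),
      (∀ u, G₁.Adj x u → c u = c' u) →
      s (Sum.inl x) (combine c d) = s (Sum.inl x) (combine c' d') := by
    intro x hx c c' d d' hc
    refine hloc _ _ _ ?_
    rintro (u | u) hu
    · simp only [SimpleGraph.glue, SimpleGraph.fromRel_adj] at hu
      exact hc u (hu.2.elim id fun h => h.symm)
    · simp [SimpleGraph.glue, hx] at hu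
  let d₀ : ∀ y, Fin (h₂ y) := fun y => ⟨0, hh₂ y⟩
  obtain ⟨c, c', hne, hagree, hc, hc'⟩ := HatGame.exists_pair_of_not_winning hl₁ v₁ (hh₁ v₁)
    (fun x c => s (Sum.inl x) (combine c d₀)) (fun x hx c c' h => hleft x hx c c' _ _ h)
  let pick : Fin (h₂ v₂) → ∀ x, Fin (h₁ x) := fun i => if i.val = 0 then c else c'
  have hpick : ∀ i, pick i = c ∨ pick i = c' := fun i => by
    by_cases hi : i.val = 0 <;> simp [pick, hi]
  have hpick_adj : ∀ i j u, G₁.Adj v₁ u → pick i u = pick j u := by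
    intro i j u hu
    have := hagree u hu
    rcases hpick i with hi | hi <;> rcases hpick j with hj | hj <;> simp [hi, hj, this]
  have hinj : Function.Injective fun i => pick i v₁ := by
    intro i j hij
    have hi := i.isLt
    have hj := j.isLt
    apply Fin.ext
    by_cases hi0 : i.val = 0 <;> by_cases hj0 : j.val = 0 <;> simp [pick, hi0, hj0] at hij
    · omega
    · exact absurd hij hne
    · exact absurd hij.symm hne
    · omega
  have : Nonempty (Fin (h₂ v₂)) := ⟨d₀ v₂⟩
  obtain ⟨r, hr⟩ := hinj.hasLeftInverse
  let join : (∀ y, Fin (h₂ y)) → _ := fun d => combine (pick (d v₂)) d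
  let s₂ : ∀ y, (∀ y, Fin (h₂ y)) → Fin (h₂ y) := fun y d =>
    if hy : y = v₂ then hy ▸ r (s (Sum.inl v₁) (join d)) else s (Sum.inr ⟨y, hy⟩) (join d)
  refine hl₂ ⟨s₂, fun y d d' hd => ?_, fun d => ?_⟩
  · by_cases hy : y = v₂
    · subst hy
      have : s (Sum.inl v₁) (join d) = s (Sum.inl v₁) (join d') := by
        refine hloc _ _ _ ?_
        rintro (u | u) hu
        · simp only [SimpleGraph.glue, SimpleGraph.fromRel_adj] at hu
          exact hpick_adj _ _ u (hu.2.elim id fun h => h.symm)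
        · simp only [SimpleGraph.glue, SimpleGraph.fromRel_adj] at hu
          exact hd u (hu.2.elim (fun h => h.2) fun h => h.2.symm)
      simp only [s₂, dif_pos, this]
    · simp only [s₂, dif_neg hy]
      refine hloc _ _ _ ?_
      rintro (u | u) hu
      · simp only [SimpleGraph.glue, SimpleGraph.fromRel_adj] at hu
        have hu' : u = v₁ ∧ G₂.Adj y v₂ := hu.2.elim id fun h => ⟨h.1, h.2.symm⟩
        change pick (d v₂) u = pick (d' v₂) u
        rw [hd v₂ hu'.2]
      · simp only [SimpleGraph.glue, SimpleGraph.fromRel_adj] at hu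
        exact hd u (hu.2.elim id fun h => h.symm)
  · obtain ⟨x | y, hv⟩ := hwin (join d)
    · rcases eq_or_ne x v₁ with rfl | hx
      · refine ⟨v₂, ?_⟩
        simp only [s₂, dif_pos, hv]
        exact hr (d v₂)
      · have hv' : s (Sum.inl x) (combine (pick (d v₂)) d₀) = pick (d v₂) x :=
          (hleft x hx _ _ _ _ fun _ _ => rfl).trans hv
        rcases hpick (d v₂) with h | h <;> rw [h] at hv'
        · exact absurd hv' (hc x hx)
        · exact absurd hv' (hc' x hx)
    · refine ⟨y, ?_⟩
      simp only [s₂, dif_neg y.2]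
      exact hv
end

section
/- Let P be a path graph and let h be a hatness function such that h(v) = 5 for some vertex v of P. Then the game ⟨P,h⟩ is winning if and only if there is a connected proper subgraph P' of P such that the subgame ⟨P', h restricted to P'⟩ is winning. -/
open Function in
/-- If the only edge leaving `S` is `w v` and the game induced on `S` is losing, then two colorings
suffice to defeat all of `S`, whatever the color of `v` is. -/
theorem HatGame.exists_pair_of_not_winning_induce {V : Type*} [DecidableEq V]
    {G : SimpleGraph V} {h : V → ℕ} (hh : ∀ x, 1 ≤ h x)
    {s : ∀ v : V, (∀ u : V, Fin (h u)) → Fin (h v)}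
    (hs : ∀ (v : V) (c c' : ∀ u : V, Fin (h u)),
      (∀ u : V, G.Adj v u → c u = c' u) → s v c = s v c')
    {S : Set V} {v w : V} (hv : v ∉ S) (hw : w ∈ S)
    (hS : ∀ u ∈ S, ∀ x ∉ S, G.Adj u x → u = w ∧ x = v)
    (hlose : ¬ HatGame.Winning (G.induce S) (fun x => h x)) :
    ∃ p : Bool → ∀ u : V, Fin (h u), ∀ d : Fin (h v), ∃ i,
      ∀ u ∈ S, s u (update (p i) v d) ≠ p i u := by
  classical
  let z : ∀ u : V, Fin (h u) := fun u => ⟨0, hh u⟩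
  have : Nonempty (∀ u : V, Fin (h u)) := ⟨z⟩
  let ext : (∀ u : S, Fin (h u)) → ∀ u : V, Fin (h u) :=
    fun c u => if hu : u ∈ S then c ⟨u, hu⟩ else z u
  let Q : (∀ u : S, Fin (h u)) → (∀ u : V, Fin (h u)) → Prop := fun c c' =>
    (∀ x : S, G.Adj w x → c' x = c x) ∧ ∀ u ∈ S, u ≠ w → s u c' ≠ c' u
  have ext_apply : ∀ c (u : S), ext c u = c u := fun c u => dif_pos u.2
  let t : ∀ u : S, (∀ x : S, Fin (h x)) → Fin (h u) := fun u c =>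
    if (u : V) = w then Classical.epsilon (Q c) u else s u (ext c)
  obtain ⟨c, hc⟩ : ∃ c, ∀ u, t u c ≠ c u := by
    by_contra! hwin
    refine hlose ⟨t, fun u c c' hcc => ?_, hwin⟩
    by_cases huw : (u : V) = w
    · have : Q c = Q c' := by
        ext e
        refine and_congr_left fun _ => forall_congr' fun x => forall_congr' fun hx => ?_
        rw [hcc x (by simpa [huw] using hx)]
      simp only [t, if_pos huw, this]
    · simp only [t, if_neg huw]
      refine hs _ _ _ fun x hx => ?_
      by_cases hxS : x ∈ S
      · rw [ext_apply c ⟨x, hxS⟩, ext_apply c' ⟨x, hxS⟩]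
        exact hcc ⟨x, hxS⟩ hx
      · exact absurd (hS u u.2 x hxS hx).1 huw
  have hQ : Q c (ext c) := by
    refine ⟨fun x _ => ext_apply c x, fun u hu huw => ?_⟩
    have := hc ⟨u, hu⟩
    simp only [t, if_neg huw] at this
    rwa [ext_apply c ⟨u, hu⟩]
  obtain ⟨hadj, hwrong⟩ : Q c (Classical.epsilon (Q c)) := Classical.epsilon_spec ⟨_, hQ⟩
  set e := Classical.epsilon (Q c)
  have hne : e w ≠ ext c w := by
    have := hc ⟨w, hw⟩
    simp only [t, if_true] at this
    rwa [ext_apply c ⟨w, hw⟩]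
  have key : ∀ (c' : ∀ u : V, Fin (h u)) (d : Fin (h v)),
      (∀ u ∈ S, u ≠ w → s u c' ≠ c' u) → s w (update c' v d) ≠ c' w →
      ∀ u ∈ S, s u (update c' v d) ≠ c' u := by
    intro c' d h1 h2 u hu
    by_cases huw : u = w
    · subst huw; exact h2
    · have : s u (update c' v d) = s u c' := hs _ _ _ fun x hx =>
        update_of_ne (by rintro rfl; exact huw (hS u hu x hv hx).1) _ _
      rw [this]; exact h1 u hu huw
  refine ⟨fun i => if i then e else ext c, fun d => ?_⟩
  by_cases h1 : s w (update e v d) = e w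
  · refine ⟨false, key _ d hQ.2 fun h2 => hne ?_⟩
    simp only [Bool.false_eq_true, if_false] at h2
    rw [← h1, ← h2]
    refine hs _ _ _ fun x hx => ?_
    by_cases hxv : x = v
    · subst hxv; simp
    · rw [update_of_ne hxv, update_of_ne hxv]
      have hxS : x ∈ S := by_contra fun hxS => hxv (hS w hw x hxS hx).2
      rw [ext_apply c ⟨x, hxS⟩]
      exact hadj ⟨x, hxS⟩ hx
  · exact ⟨true, key _ d hwrong h1⟩

/-- A winning strategy on a subgraph extends to the whole graph. -/
theorem HatGame.Winning.of_subgraph {V : Type*} {G : SimpleGraph V} {h : V → ℕ}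
    (hh : ∀ x, 1 ≤ h x) (G' : G.Subgraph)
    (hwin : HatGame.Winning G'.coe (fun x => h x.val)) : HatGame.Winning G h := by
  classical
  obtain ⟨s, hs, hwin⟩ := hwin
  refine ⟨fun v c => if hv : v ∈ G'.verts then s ⟨v, hv⟩ (fun u => c u) else ⟨0, hh v⟩,
    fun v c c' hcc => ?_, fun c => ?_⟩
  · by_cases hv : v ∈ G'.verts
    · simp only [dif_pos hv]
      exact hs _ _ _ fun u hu => hcc u (G'.coe_adj_sub _ _ hu)
    · simp only [dif_neg hv]
  · obtain ⟨u, hu⟩ := hwin fun u => c u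
    exact ⟨u, by simpa using hu⟩

theorem SimpleGraph.pathGraph_induce_connected {n : ℕ} {S : Set (Fin n)} (hS : S.OrdConnected)
    (hne : S.Nonempty) : ((pathGraph n).induce S).Connected := by
  have main : ∀ (k : ℕ) (x y : S), (x : Fin n).val + k = (y : Fin n).val →
      ((pathGraph n).induce S).Reachable x y := by
    intro k
    induction k with
    | zero =>
      intro x y hxy
      rw [Subtype.ext (Fin.ext hxy) (a1 := x) (a2 := y)]
    | succ k ih =>
      intro x y hxy
      have hlt := (y : Fin n).isLt
      let m : Fin n := ⟨(x : Fin n).val + k, by lia⟩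
      have hm : m ∈ S := hS.out x.2 y.2
        ⟨Fin.le_def.2 (Nat.le_add_right _ _), Fin.le_def.2 (by simp only [m]; lia)⟩
      refine (ih x ⟨m, hm⟩ rfl).trans (SimpleGraph.Adj.reachable ?_)
      simp only [comap_adj, Function.Embedding.subtype_apply, pathGraph_adj]
      left
      simp only [m]
      lia
  have : Nonempty S := hne.to_subtype
  refine ⟨fun x y => ?_⟩
  rcases le_total (x : Fin n).val (y : Fin n).val with hxy | hxy
  · exact main _ x y (Nat.add_sub_cancel' hxy)
  · exact (main _ y x (Nat.add_sub_cancel' hxy)).symm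

open Function in
/-- On a path, two colorings suffice to defeat an interval `S` that is losing and has `v` as its
only outside neighbor. -/
theorem HatGame.exists_pair_of_forall_not_winning {n : ℕ} {h : Fin n → ℕ} (hh : ∀ x, 1 ≤ h x)
    {s : ∀ v : Fin n, (∀ u : Fin n, Fin (h u)) → Fin (h v)}
    (hs : ∀ (v : Fin n) (c c' : ∀ u : Fin n, Fin (h u)),
      (∀ u : Fin n, (SimpleGraph.pathGraph n).Adj v u → c u = c' u) → s v c = s v c')
    (hlose : ∀ G' : (SimpleGraph.pathGraph n).Subgraph, G' ≠ ⊤ → G'.Connected →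
      ¬ HatGame.Winning G'.coe (fun x => h x.val))
    {S : Set (Fin n)} (hS : S.OrdConnected) {v : Fin n} (hv : v ∉ S)
    (hw : ∀ x ∈ S, ∃ w ∈ S, ∀ u ∈ S, ∀ x ∉ S,
      (SimpleGraph.pathGraph n).Adj u x → u = w ∧ x = v) :
    ∃ p : Bool → ∀ u : Fin n, Fin (h u), ∀ d : Fin (h v), ∃ i,
      ∀ u ∈ S, s u (update (p i) v d) ≠ p i u := by
  rcases S.eq_empty_or_nonempty with rfl | ⟨x, hx⟩
  · exact ⟨fun _ u => ⟨0, hh u⟩, fun _ => ⟨true, by simp⟩⟩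
  · obtain ⟨w, hwS, hw⟩ := hw x hx
    refine exists_pair_of_not_winning_induce hh hs hv hwS hw ?_
    have hconn := SimpleGraph.pathGraph_induce_connected hS ⟨x, hx⟩
    rw [SimpleGraph.induce_eq_coe_induce_top] at hconn ⊢
    refine hlose _ (fun htop => hv ?_) ⟨hconn⟩
    have : v ∈ (⊤ : (SimpleGraph.pathGraph n).Subgraph).verts := Set.mem_univ v
    rw [← htop] at this
    exact this

/-- A path with a vertex of hatness 5 is winning iff some connected proper
subgraph of it is winning (with the restricted hatness function). -/
theorem path_with_hatness_five_winning_iff (n : ℕ) (h : Fin n → ℕ)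
    (hh : ∀ x, 1 ≤ h x) (v : Fin n) (hv : h v = 5) :
    HatGame.Winning (SimpleGraph.pathGraph n) h ↔
      ∃ G' : (SimpleGraph.pathGraph n).Subgraph, G' ≠ ⊤ ∧ G'.Connected ∧
        HatGame.Winning G'.coe (fun x => h x.val) := by
  refine ⟨fun hwin => ?_, fun ⟨G', _, _, hG'⟩ => HatGame.Winning.of_subgraph hh G' hG'⟩
  by_contra! hlose
  obtain ⟨s, hs, hwin⟩ := hwin
  obtain ⟨p, hp⟩ := HatGame.exists_pair_of_forall_not_winning hh hs hlose
    (S := Set.Iio v) Set.ordConnected_Iio (v := v) (lt_irrefl v) (by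
      intro x hx
      simp only [Set.mem_Iio, Fin.lt_def, SimpleGraph.pathGraph_adj, Fin.ext_iff] at hx ⊢
      exact ⟨⟨v.val - 1, by lia⟩, by simp only; lia, by intros; simp only; lia⟩)
  obtain ⟨q, hq⟩ := HatGame.exists_pair_of_forall_not_winning hh hs hlose
    (S := Set.Ioi v) Set.ordConnected_Ioi (v := v) (lt_irrefl v) (by
      intro x hx
      simp only [Set.mem_Ioi, Fin.lt_def, SimpleGraph.pathGraph_adj, Fin.ext_iff] at hx ⊢
      exact ⟨⟨v.val + 1, by lia⟩, by simp only; lia, by intros; simp only; lia⟩)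
  choose i hi using hp
  choose j hj using hq
  obtain ⟨d, d', hdd, hij⟩ := Fintype.exists_ne_map_eq_of_card_lt (fun d => (i d, j d))
    (by simp [hv])
  obtain ⟨hii, hjj⟩ := Prod.mk.inj hij
  let e : ∀ u, Fin (h u) := fun u => if u < v then p (i d) u else q (j d) u
  have defeat : ∀ x, i x = i d → j x = j d → s v (Function.update e v x) = x := by
    intro x hix hjx
    obtain ⟨u, hu⟩ := hwin (Function.update e v x)
    rcases lt_trichotomy u v with huv | rfl | huv
    · refine absurd ?_ (hi x u huv)
      rw [Function.update_of_ne huv.ne] at hu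
      rw [hix, show p (i d) u = e u from (if_pos huv).symm, ← hu]
      refine hs _ _ _ fun y hy => ?_
      rcases eq_or_ne y v with rfl | hyv
      · simp
      · have hlt : y < v := by
          rw [SimpleGraph.pathGraph_adj] at hy
          lia
        rw [Function.update_of_ne hyv, Function.update_of_ne hyv]
        exact (if_pos hlt).symm
    · simpa using hu
    · refine absurd ?_ (hj x u huv)
      rw [Function.update_of_ne huv.ne'] at hu
      rw [hjx, show q (j d) u = e u from (if_neg huv.not_gt).symm, ← hu]
      refine hs _ _ _ fun y hy => ?_
      rcases eq_or_ne y v with rfl | hyv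
      · simp
      · have hlt : ¬ y < v := by
          rw [SimpleGraph.pathGraph_adj] at hy
          lia
        rw [Function.update_of_ne hyv, Function.update_of_ne hyv]
        exact (if_neg hlt).symm
  refine hdd ?_
  rw [← defeat d rfl rfl, ← defeat d' hii.symm hjj.symm]
  refine hs _ _ _ fun y hy => ?_
  rw [Function.update_of_ne hy.ne', Function.update_of_ne hy.ne']
end

section
/- Let C be a cycle on n ≥ 4 vertices and let h be a hatness function such that some vertex a has h(a) = 2, both neighbors of a have hatness 4, and every other vertex of C has hatness 3. Then the game ⟨C,h⟩ is losing. -/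
namespace HatGame

/-- A hat guessing game on a path with inner vertices `1, …, k + 1`, whose end colors are fixed:
if every inner vertex before the last one has at least three available colors, then for any two
colors available at the last inner vertex, one of them occurs in a coloring refuting all guesses. -/
theorem exists_path_coloring_last (G : ℕ → ℕ → ℕ → ℕ) (L : ℕ → Finset ℕ) (l k : ℕ)
    (hL : ∀ i, 1 ≤ i → i ≤ k → 2 < (L i).card) (r y y' : ℕ) (hy : y ∈ L (k + 1))
    (hy' : y' ∈ L (k + 1)) (hne : y ≠ y') :
    ∃ c : ℕ → ℕ, c 0 = l ∧ c (k + 2) = r ∧ (c (k + 1) = y ∨ c (k + 1) = y') ∧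
      ∀ i, 1 ≤ i → i ≤ k + 1 → c i ∈ L i ∧ G i (c (i - 1)) (c (i + 1)) ≠ c i := by
  induction k generalizing r y y' with
  | zero =>
    have key : ∀ z ∈ L 1, G 1 l r ≠ z → ∃ c : ℕ → ℕ, c 0 = l ∧ c 2 = r ∧ c 1 = z ∧
        ∀ i, 1 ≤ i → i ≤ 1 → c i ∈ L i ∧ G i (c (i - 1)) (c (i + 1)) ≠ c i := by
      intro z hz hG
      refine ⟨fun i => if i = 0 then l else if i = 1 then z else r, by simp, by simp, by simp, ?_⟩
      intro i h1 h2
      obtain rfl : i = 1 := by omega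
      simpa using ⟨hz, hG⟩
    by_cases h : G 1 l r = y
    · obtain ⟨c, h0, h2, h1, hc⟩ := key y' hy' (by omega)
      exact ⟨c, h0, h2, Or.inr h1, hc⟩
    · obtain ⟨c, h0, h2, h1, hc⟩ := key y hy h
      exact ⟨c, h0, h2, Or.inl h1, hc⟩
  | succ k ih =>
    let Ok : ℕ → ℕ → Prop := fun x z => ∃ c : ℕ → ℕ, c 0 = l ∧ c (k + 2) = z ∧ c (k + 1) = x ∧
      ∀ i, 1 ≤ i → i ≤ k + 1 → c i ∈ L i ∧ G i (c (i - 1)) (c (i + 1)) ≠ c i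
    have hOk : ∀ z, ∀ x ∈ L (k + 1), ∀ x' ∈ L (k + 1), x ≠ x' → Ok x z ∨ Ok x' z := by
      intro z x hx x' hx' hxx
      obtain ⟨c, h0, h2, h1 | h1, hc⟩ :=
        ih (fun i h1 h2 => hL i h1 (by omega)) z x x' hx hx' hxx
      · exact Or.inl ⟨c, h0, h2, h1, hc⟩
      · exact Or.inr ⟨c, h0, h2, h1, hc⟩
    have extend : ∀ x, ∀ z ∈ L (k + 2), Ok x z → G (k + 2) x r ≠ z →
        ∃ c : ℕ → ℕ, c 0 = l ∧ c (k + 3) = r ∧ c (k + 2) = z ∧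
          ∀ i, 1 ≤ i → i ≤ k + 2 → c i ∈ L i ∧ G i (c (i - 1)) (c (i + 1)) ≠ c i := by
      rintro x z hz ⟨c, h0, h2, h1, hc⟩ hG
      refine ⟨Function.update c (k + 3) r, by simp [h0], by simp, by simp [h2], ?_⟩
      intro i hi1 hi2
      rcases Nat.lt_or_ge i (k + 2) with h | h
      · rw [Function.update_of_ne (by omega), Function.update_of_ne (by omega),
          Function.update_of_ne (by omega)]
        exact hc i hi1 (by omega)
      · obtain rfl : i = k + 2 := by omega
        simp [h1, h2, hz, hG]
    have common : ∃ x, Ok x y ∧ Ok x y' := by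
      obtain ⟨p, hp, q, hq, s, hs, hpq, hps, hqs⟩ :=
        Finset.two_lt_card.1 (hL (k + 1) (by omega) le_rfl)
      have := hOk y p hp q hq hpq
      have := hOk y p hp s hs hps
      have := hOk y q hq s hs hqs
      have := hOk y' p hp q hq hpq
      have := hOk y' p hp s hs hps
      have := hOk y' q hq s hs hqs
      clear_value Ok
      by_contra! hcon
      have := hcon p
      have := hcon q
      have := hcon s
      tauto
    obtain ⟨x, hx, hx'⟩ := common
    by_cases h : G (k + 2) x r = y
    · obtain ⟨c, h0, h2, h1, hc⟩ := extend x y' hy' hx' (by omega)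
      exact ⟨c, h0, h2, Or.inr h1, hc⟩
    · obtain ⟨c, h0, h2, h1, hc⟩ := extend x y hy hx h
      exact ⟨c, h0, h2, Or.inl h1, hc⟩

/-- The adversary wins on a path with at least three colors at every inner vertex except the last
one, which has at least two. -/
theorem exists_path_coloring_of_last (G : ℕ → ℕ → ℕ → ℕ) (L : ℕ → Finset ℕ) (l r m : ℕ)
    (hm : 1 ≤ m) (hL : ∀ i, 1 ≤ i → i < m → 2 < (L i).card) (hlast : 1 < (L m).card) :
    ∃ c : ℕ → ℕ, c 0 = l ∧ c (m + 1) = r ∧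
      ∀ i, 1 ≤ i → i ≤ m → c i ∈ L i ∧ G i (c (i - 1)) (c (i + 1)) ≠ c i := by
  obtain ⟨k, rfl⟩ := Nat.exists_eq_add_of_le' hm
  obtain ⟨y, hy, y', hy', hne⟩ := Finset.one_lt_card.1 hlast
  obtain ⟨c, h0, h2, -, hc⟩ := exists_path_coloring_last G L l k
    (fun i h1 h2 => hL i h1 (by omega)) r y y' hy hy' hne
  exact ⟨c, h0, h2, hc⟩

/-- The adversary wins on a path with at least three colors at every inner vertex except the first
one, which has at least two. -/
theorem exists_path_coloring_of_first (G : ℕ → ℕ → ℕ → ℕ) (L : ℕ → Finset ℕ) (l r m : ℕ)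
    (hm : 1 ≤ m) (hL : ∀ i, 1 < i → i ≤ m → 2 < (L i).card) (hfirst : 1 < (L 1).card) :
    ∃ c : ℕ → ℕ, c 0 = l ∧ c (m + 1) = r ∧
      ∀ i, 1 ≤ i → i ≤ m → c i ∈ L i ∧ G i (c (i - 1)) (c (i + 1)) ≠ c i := by
  obtain ⟨c, h0, h1, hc⟩ := exists_path_coloring_of_last (fun i x y => G (m + 1 - i) y x)
    (fun i => L (m + 1 - i)) r l m hm (fun i h1 h2 => hL _ (by omega) (by omega))
    (by simpa using hfirst)
  refine ⟨fun i => c (m + 1 - i), by simpa using h1, by simpa using h0, ?_⟩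
  intro i hi1 hi2
  have := hc (m + 1 - i) (by omega) (by omega)
  rw [show m + 1 - (m + 1 - i) = i by omega, show m + 1 - i - 1 = m + 1 - (i + 1) by omega,
    show m + 1 - i + 1 = m + 1 - (i - 1) by omega] at this
  exact this

/-- Positions `0, …, m + 3` go once around a cycle, with `0` and `m + 3` the same vertex. There is
a coloring of the cycle with color `x` at this vertex and colors `p`, `q` at its neighbors, and
three colors at all other vertices, that refutes all guesses except possibly the one at `0`. -/
def Reachable (G : ℕ → ℕ → ℕ → ℕ) (m x p q : ℕ) : Prop :=
  ∃ c : ℕ → ℕ, c 0 = x ∧ c (m + 3) = x ∧ c 1 = p ∧ c (m + 2) = q ∧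
    (∀ i, 2 ≤ i → i ≤ m + 1 → c i < 3) ∧
    ∀ i, 1 ≤ i → i ≤ m + 2 → G i (c (i - 1)) (c (i + 1)) ≠ c i

/-- `g` never guesses `p`. -/
def Avoids (g : ℕ → ℕ) (p : ℕ) : Prop := ∀ y < 3, g y ≠ p

/-- `g` guesses `p` on at most one of three inputs. -/
def MostlyAvoids (g : ℕ → ℕ) (p : ℕ) : Prop :=
  1 < ((Finset.range 3).filter fun y => g y ≠ p).card

theorem not_mostlyAvoids_iff {g : ℕ → ℕ} {p : ℕ} : ¬ MostlyAvoids g p ↔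
    (g 0 = p ∧ g 1 = p) ∨ (g 0 = p ∧ g 2 = p) ∨ (g 1 = p ∧ g 2 = p) := by
  unfold MostlyAvoids
  rw [Finset.card_filter]
  simp only [Finset.sum_range_succ, Finset.sum_range_zero]
  split_ifs <;> omega

theorem avoids_iff {g : ℕ → ℕ} {p : ℕ} : Avoids g p ↔ g 0 ≠ p ∧ g 1 ≠ p ∧ g 2 ≠ p := by
  refine ⟨fun h => ⟨h 0 (by omega), h 1 (by omega), h 2 (by omega)⟩, ?_⟩
  rintro ⟨h0, h1, h2⟩ y hy
  interval_cases y <;> assumption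

theorem exists_avoids (g : ℕ → ℕ) : ∃ p < 4, Avoids g p := by
  simp only [avoids_iff]
  by_contra! h
  have h0 := h 0 (by omega)
  have h1 := h 1 (by omega)
  have h2 := h 2 (by omega)
  have h3 := h 3 (by omega)
  omega

theorem exists_avoids_of_not_mostlyAvoids {g : ℕ → ℕ} {p : ℕ} (h : ¬ MostlyAvoids g p) :
    ∃ k, ∀ q, q ≠ p → q ≠ k → Avoids g q := by
  simp only [avoids_iff]
  rcases not_mostlyAvoids_iff.1 h with h | h | h
  · exact ⟨g 2, by omega⟩
  · exact ⟨g 1, by omega⟩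
  · exact ⟨g 0, by omega⟩

theorem mostlyAvoids_of_ne {g : ℕ → ℕ} {p q : ℕ} (h : ¬ MostlyAvoids g p) (hq : q ≠ p) :
    MostlyAvoids g q := by
  by_contra h'
  rw [not_mostlyAvoids_iff] at h h'
  omega

theorem one_lt_card_range_four_sdiff (p k : ℕ) : 1 < (Finset.range 4 \ {p, k}).card := by
  have := Finset.le_card_sdiff {p, k} (Finset.range 4)
  have := Finset.card_le_two (a := p) (b := k)
  rw [Finset.card_range] at *
  omega

theorem two_lt_card_range_four_sdiff (p : ℕ) : 2 < (Finset.range 4 \ {p}).card := by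
  have := Finset.le_card_sdiff {p} (Finset.range 4)
  rw [Finset.card_range, Finset.card_singleton] at this
  omega

theorem exists_avoids_mostlyAvoids (g g' : ℕ → ℕ) :
    (∃ p < 4, Avoids g p ∧ MostlyAvoids g' p) ∨ ∃ p < 4, Avoids g' p ∧ MostlyAvoids g p := by
  by_contra! h
  obtain ⟨p, hp, hp'⟩ := exists_avoids g'
  obtain ⟨k, hk⟩ := exists_avoids_of_not_mostlyAvoids (h.2 p hp hp')
  obtain ⟨a, ha, b, hb, hab⟩ := Finset.one_lt_card.1 (one_lt_card_range_four_sdiff p k)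
  simp only [Finset.mem_sdiff, Finset.mem_range, Finset.mem_insert, Finset.mem_singleton,
    not_or] at ha hb
  exact h.1 b hb.1 (hk b hb.2.1 hb.2.2)
    (mostlyAvoids_of_ne (h.1 a ha.1 (hk a ha.2.1 ha.2.2)) hab.symm)

/-- A coloring of the vertices `2, …, m + 1` compatible with the end vertices extends to a witness
of reachability. -/
theorem reachable_of_inner {G : ℕ → ℕ → ℕ → ℕ} {m x p q : ℕ} (c : ℕ → ℕ)
    (h0 : c 0 = p) (h1 : c (m + 1) = q) (hp : G 1 x (c 1) ≠ p) (hq : G (m + 2) (c m) x ≠ q)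
    (hc : ∀ i, 1 ≤ i → i ≤ m → c i < 3 ∧ G (i + 1) (c (i - 1)) (c (i + 1)) ≠ c i) :
    Reachable G m x p q := by
  refine ⟨fun i => if i = 0 ∨ i = m + 3 then x else c (i - 1), by simp, by simp, by simpa using h0,
    by simpa using h1, ?_, ?_⟩
  · intro i h2 h3
    beta_reduce
    rw [if_neg (by omega)]
    exact (hc (i - 1) (by omega) (by omega)).1
  · intro i h2 h3
    rcases Nat.eq_or_lt_of_le h2 with rfl | h2
    · simpa [h0] using hp
    rcases Nat.eq_or_lt_of_le h3 with rfl | h3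
    · simpa [h1] using hq
    have := (hc (i - 1) (by omega) (by omega)).2
    beta_reduce
    rw [if_neg (by omega), if_neg (by omega), if_neg (by omega)]
    rwa [show i - 1 + 1 = i + 1 - 1 by omega, show i + 1 - 1 = i by omega] at this

theorem reachable_of_avoids_left {G : ℕ → ℕ → ℕ → ℕ} {m x p q : ℕ} (hm : 1 ≤ m)
    (hp : Avoids (fun y => G 1 x y) p) (hq : MostlyAvoids (fun y => G (m + 2) y x) q) :
    Reachable G m x p q := by
  obtain ⟨c, h0, h1, hc⟩ := exists_path_coloring_of_last (fun i => G (i + 1))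
    (fun i => if i = m then (Finset.range 3).filter fun y => G (m + 2) y x ≠ q
      else Finset.range 3) p q m hm
    (fun i _ h => by simp [h.ne]) (by rw [if_pos rfl]; exact hq)
  have hlt : ∀ i, 1 ≤ i → i ≤ m → c i < 3 := by
    intro i hi1 hi2
    have := (hc i hi1 hi2).1
    split_ifs at this
    · exact Finset.mem_range.1 (Finset.mem_filter.1 this).1
    · exact Finset.mem_range.1 this
  refine reachable_of_inner c h0 h1 (hp _ (hlt 1 le_rfl hm)) ?_
    fun i hi1 hi2 => ⟨hlt i hi1 hi2, (hc i hi1 hi2).2⟩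
  have := (hc m hm le_rfl).1
  rw [if_pos rfl] at this
  exact (Finset.mem_filter.1 this).2

theorem reachable_of_avoids_right {G : ℕ → ℕ → ℕ → ℕ} {m x p q : ℕ} (hm : 1 ≤ m)
    (hp : MostlyAvoids (fun y => G 1 x y) p) (hq : Avoids (fun y => G (m + 2) y x) q) :
    Reachable G m x p q := by
  obtain ⟨c, h0, h1, hc⟩ := exists_path_coloring_of_first (fun i => G (i + 1))
    (fun i => if i = 1 then (Finset.range 3).filter fun y => G 1 x y ≠ p
      else Finset.range 3) p q m hm
    (fun i h _ => by simp [h.ne']) (by rw [if_pos rfl]; exact hp)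
  have hlt : ∀ i, 1 ≤ i → i ≤ m → c i < 3 := by
    intro i hi1 hi2
    have := (hc i hi1 hi2).1
    split_ifs at this
    · exact Finset.mem_range.1 (Finset.mem_filter.1 this).1
    · exact Finset.mem_range.1 this
  refine reachable_of_inner c h0 h1 ?_ (hq _ (hlt m hm le_rfl))
    fun i hi1 hi2 => ⟨hlt i hi1 hi2, (hc i hi1 hi2).2⟩
  have := (hc 1 le_rfl hm).1
  rw [if_pos rfl] at this
  exact (Finset.mem_filter.1 this).2

/-- Excluding two of the four colors at one neighbor and one color at the other leaves a
reachable pair. -/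
theorem exists_reachable (G : ℕ → ℕ → ℕ → ℕ) (m x p k q : ℕ) :
    ∃ p' < 4, ∃ q' < 4, p' ≠ p ∧ p' ≠ k ∧ q' ≠ q ∧ Reachable G m x p' q' := by
  obtain ⟨c, h0, h1, hc⟩ := exists_path_coloring_of_first G
    (fun i => if i = 1 then Finset.range 4 \ {p, k} else
      if i = m + 2 then Finset.range 4 \ {q} else Finset.range 3) x x (m + 2) (by omega)
    (fun i h _ => by
      rw [if_neg h.ne']
      split_ifs
      · exact two_lt_card_range_four_sdiff q
      · simp)
    (by simpa using one_lt_card_range_four_sdiff p k)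
  have hfirst := (hc 1 le_rfl (by omega)).1
  have hlast := (hc (m + 2) (by omega) le_rfl).1
  rw [if_pos rfl] at hfirst
  rw [if_neg (by omega), if_pos rfl] at hlast
  simp only [Finset.mem_sdiff, Finset.mem_range, Finset.mem_insert, Finset.mem_singleton,
    not_or] at hfirst hlast
  refine ⟨c 1, hfirst.1, c (m + 2), hlast.1, hfirst.2.1, hfirst.2.2, hlast.2, c, h0, h1, rfl, rfl,
    ?_, fun i hi1 hi2 => (hc i hi1 hi2).2⟩
  intro i hi1 hi2
  have := (hc i (by omega) (by omega)).1
  rw [if_neg (by omega), if_neg (by omega)] at this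
  exact Finset.mem_range.1 this

theorem exists_reachable_both_of_avoids {G : ℕ → ℕ → ℕ → ℕ} {m x x' : ℕ} (hm : 1 ≤ m)
    (hp : ∃ p < 4, Avoids (fun y => G 1 x y) p ∧ MostlyAvoids (fun y => G 1 x' y) p)
    (hq : ∃ q < 4, Avoids (fun y => G (m + 2) y x') q ∧
      MostlyAvoids (fun y => G (m + 2) y x) q) :
    ∃ p < 4, ∃ q < 4, Reachable G m x p q ∧ Reachable G m x' p q := by
  obtain ⟨p, hp4, hp, hp'⟩ := hp
  obtain ⟨q, hq4, hq, hq'⟩ := hq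
  exact ⟨p, hp4, q, hq4, reachable_of_avoids_left hm hp hq', reachable_of_avoids_right hm hp' hq⟩

theorem exists_reachable_both_of_not_avoids {G : ℕ → ℕ → ℕ → ℕ} {m x x' : ℕ} (hm : 1 ≤ m)
    (hp : ¬ ∃ p < 4, Avoids (fun y => G 1 x y) p ∧ MostlyAvoids (fun y => G 1 x' y) p)
    (hq : ¬ ∃ q < 4, Avoids (fun y => G (m + 2) y x) q ∧
      MostlyAvoids (fun y => G (m + 2) y x') q) :
    ∃ p < 4, ∃ q < 4, Reachable G m x p q ∧ Reachable G m x' p q := by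
  obtain ⟨p, hp4, hpa⟩ := exists_avoids fun y => G 1 x y
  obtain ⟨q, hq4, hqa⟩ := exists_avoids fun y => G (m + 2) y x
  have hp' : ¬ MostlyAvoids (fun y => G 1 x' y) p := fun h => hp ⟨p, hp4, hpa, h⟩
  have hq' : ¬ MostlyAvoids (fun y => G (m + 2) y x') q := fun h => hq ⟨q, hq4, hqa, h⟩
  obtain ⟨k, hk⟩ := exists_avoids_of_not_mostlyAvoids hp'
  obtain ⟨p', hp4', q', hq4', hpp, hpk, hqq, h⟩ := exists_reachable G m x p k q
  exact ⟨p', hp4', q', hq4', h,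
    reachable_of_avoids_left hm (hk p' hpp hpk) (mostlyAvoids_of_ne hq' hqq)⟩

theorem exists_reachable_both (G : ℕ → ℕ → ℕ → ℕ) {m : ℕ} (x x' : ℕ) (hm : 1 ≤ m) :
    ∃ p < 4, ∃ q < 4, Reachable G m x p q ∧ Reachable G m x' p q := by
  have hp := exists_avoids_mostlyAvoids (fun y => G 1 x y) (fun y => G 1 x' y)
  have hq := exists_avoids_mostlyAvoids (fun y => G (m + 2) y x) (fun y => G (m + 2) y x')
  by_cases hp0 : ∃ p < 4, Avoids (fun y => G 1 x y) p ∧ MostlyAvoids (fun y => G 1 x' y) p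
  · by_cases hq1 : ∃ q < 4, Avoids (fun y => G (m + 2) y x') q ∧
        MostlyAvoids (fun y => G (m + 2) y x) q
    · exact exists_reachable_both_of_avoids hm hp0 hq1
    · have hq0 := hq.resolve_right hq1
      by_cases hp1 : ∃ p < 4, Avoids (fun y => G 1 x' y) p ∧ MostlyAvoids (fun y => G 1 x y) p
      · obtain ⟨p, hp, q, hq, h, h'⟩ := exists_reachable_both_of_avoids hm hp1 hq0
        exact ⟨p, hp, q, hq, h', h⟩
      · obtain ⟨p, hp, q, hq, h, h'⟩ := exists_reachable_both_of_not_avoids hm hp1 hq1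
        exact ⟨p, hp, q, hq, h', h⟩
  · have hp1 := hp.resolve_left hp0
    by_cases hq0 : ∃ q < 4, Avoids (fun y => G (m + 2) y x) q ∧
        MostlyAvoids (fun y => G (m + 2) y x') q
    · obtain ⟨p, hp, q, hq, h, h'⟩ := exists_reachable_both_of_avoids hm hp1 hq0
      exact ⟨p, hp, q, hq, h', h⟩
    · exact exists_reachable_both_of_not_avoids hm hp0 hq0

/-- For arbitrary guessing functions on a cycle with positions `0, …, m + 3`, where `0` and `m + 3`
are the same vertex, some coloring refutes all guesses. -/
theorem exists_cycle_coloring_s9 (G : ℕ → ℕ → ℕ → ℕ) {m : ℕ} (hm : 1 ≤ m) :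
    ∃ c : ℕ → ℕ, c 0 < 2 ∧ c (m + 3) = c 0 ∧ c 1 < 4 ∧ c (m + 2) < 4 ∧
      (∀ i, 2 ≤ i → i ≤ m + 1 → c i < 3) ∧ G 0 (c (m + 2)) (c 1) ≠ c 0 ∧
      ∀ i, 1 ≤ i → i ≤ m + 2 → G i (c (i - 1)) (c (i + 1)) ≠ c i := by
  obtain ⟨p, hp, q, hq, ⟨c, h0, h0', h1, h2, h3, hc⟩, ⟨d, k0, k0', k1, k2, k3, hd⟩⟩ :=
    exists_reachable_both G 0 1 hm
  by_cases h : G 0 q p = 0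
  · exact ⟨d, by omega, by omega, by omega, by omega, k3, by rw [k1, k2, k0]; omega, hd⟩
  · exact ⟨c, by omega, by omega, by omega, by omega, h3, by rw [h1, h2, h0]; omega, hc⟩

end HatGame

/-- A cycle on `n ≥ 4` vertices with one vertex of hatness 2 whose two neighbors
have hatness 4, and all other vertices of hatness 3, is losing. -/
theorem cycle_424_losing (n : ℕ) [NeZero n] (hn : 4 ≤ n) (h : Fin n → ℕ)
    (a : Fin n) (ha : h a = 2)
    (hnbr : ∀ b, (SimpleGraph.cycleGraph n).Adj a b → h b = 4)
    (hother : ∀ b, b ≠ a → ¬ (SimpleGraph.cycleGraph n).Adj a b → h b = 3) :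
    ¬ HatGame.Winning (SimpleGraph.cycleGraph n) h := by
  rintro ⟨s, hs, hwin⟩
  obtain ⟨m, rfl⟩ := Nat.exists_eq_add_of_le' (show 3 ≤ n by omega)
  have hm : 1 ≤ m := by omega
  have hadj : ∀ u v, (SimpleGraph.cycleGraph (m + 3)).Adj u v ↔ v = u - 1 ∨ v = u + 1 := by
    intro u v
    rw [SimpleGraph.cycleGraph_adj]
    constructor
    · rintro (h | h)
      · exact Or.inl (by rw [← h]; abel)
      · exact Or.inr (by rw [← h]; abel)
    · rintro (rfl | rfl)
      · exact Or.inl (by abel)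
      · exact Or.inr (by abel)
  have hpos : ∀ u, 0 < h u := by
    intro u
    by_cases hu : u = a
    · rw [hu, ha]; omega
    by_cases hu' : (SimpleGraph.cycleGraph (m + 3)).Adj a u
    · rw [hnbr u hu']; omega
    · rw [hother u hu hu']; omega
  let col : (Fin (m + 3) → ℕ) → ∀ u, Fin (h u) := fun d u => ⟨d u % h u, Nat.mod_lt _ (hpos u)⟩
  let v : ℕ → Fin (m + 3) := fun i => a + Fin.ofNat (m + 3) i
  obtain ⟨c, h0, hlast, h1, h2, h3, hG0, hG⟩ := HatGame.exists_cycle_coloring_s9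
    (fun i l r => (s (v i) (col fun u => if u = v i + 1 then r else l)).val) hm
  obtain ⟨w, hw⟩ := hwin (col fun u => c (u - a).val)
  have hval : ∀ i < m + 3, (v i - a).val = i := by
    intro i hi
    simp only [v, add_sub_cancel_left, Fin.val_ofNat]
    exact Nat.mod_eq_of_lt hi
  have hvsucc : ∀ i, v (i + 1) = v i + 1 := by
    intro i
    have : Fin.ofNat (m + 3) (i + 1) = Fin.ofNat (m + 3) i + 1 := by
      ext; simp [Fin.val_add]
    simp only [v, this, add_assoc]
  have hv0 : v 0 = a := by
    simp [v]
  have hvn : v (m + 3) = a := by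
    simp [v]
  have hvlast : v (m + 2) = a - 1 := by
    rw [← hvn, hvsucc (m + 2), add_sub_cancel_right]
  have hne : ∀ u : Fin (m + 3), u - 1 ≠ u + 1 := by
    intro u hu
    have h2 : (1 : Fin (m + 3)) + 1 = 0 := by
      have : u + 1 - (u - 1) = 0 := by rw [hu]; abel
      rw [← this]; abel
    have := congrArg Fin.val h2
    rw [Fin.val_add, Fin.val_one, Fin.val_zero, Nat.mod_eq_of_lt (by omega)] at this
    omega
  have guess : ∀ u l r, c (u - 1 - a).val = l → c (u + 1 - a).val = r →
      s u (col fun u => c (u - a).val) = s u (col fun t => if t = u + 1 then r else l) := by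
    intro u l r hl hr
    refine hs u _ _ fun t ht => ?_
    rcases (hadj u t).1 ht with rfl | rfl
    · simp only [col, if_neg (hne u), hl]
    · simp only [col, if_true, hr]
  have hlt : ∀ i < m + 3, c i < h (v i) := by
    intro i hi
    by_cases hi0 : i = 0
    · rw [hi0, hv0, ha]; exact h0
    by_cases hi1 : i = 1
    · rw [hi1, hnbr _ ((hadj _ _).2 (Or.inr (by rw [hvsucc 0, hv0])))]; exact h1
    by_cases hi2 : i = m + 2
    · rw [hi2, hnbr _ ((hadj _ _).2 (Or.inl hvlast))]; exact h2
    have hinj : ∀ j < m + 3, v i = v j → i = j := by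
      intro j hj hij
      rw [← hval i hi, hij, hval j hj]
    rw [hother]
    · exact h3 i (by omega) (by omega)
    · rw [← hv0]
      exact fun h => hi0 (hinj 0 (by omega) h)
    · rw [hadj, ← hvlast, ← hv0, ← hvsucc 0]
      rintro (h | h)
      · exact hi2 (hinj _ (by omega) h)
      · exact hi1 (hinj _ (by omega) h)
  obtain ⟨i, hi, rfl⟩ : ∃ i < m + 3, v i = w := by
    refine ⟨(w - a).val, (w - a).isLt, ?_⟩
    simp [v]
  have hcol : (col (fun u => c (u - a).val) (v i)).val = c i := by
    simp only [col, hval i hi]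
    exact Nat.mod_eq_of_lt (hlt i hi)
  have hw' := congrArg Fin.val hw
  rw [hcol] at hw'
  rcases Nat.eq_zero_or_pos i with rfl | hi0
  · refine hG0 ?_
    rw [guess (v 0) (c (m + 2)) (c 1)] at hw'
    · exact hw'
    · rw [hv0, ← hvlast, hval _ (by omega)]
    · rw [← hvsucc, hval _ (by omega)]
  · refine hG i hi0 (by omega) ?_
    rw [guess (v i) (c (i - 1)) (c (i + 1))] at hw'
    · exact hw'
    · obtain ⟨j, rfl⟩ := Nat.exists_eq_add_of_le' hi0
      rw [hvsucc, add_sub_cancel_right, hval _ (by omega), Nat.add_sub_cancel]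
    · rw [← hvsucc]
      rcases Nat.lt_or_ge (i + 1) (m + 3) with hi' | hi'
      · rw [hval _ hi']
      · obtain rfl : i = m + 2 := by omega
        rw [hvn, sub_self, hlast]
        rfl
end

section
/- Let C be a cycle on n ≥ 4 vertices and let h be a hatness function such that there are four consecutive vertices v, a, b, c of C with h(v) = 4, h(a) = 2, h(b) = 3, h(c) = 4, and every other vertex of C has hatness 3. Then the game ⟨C,h⟩ is losing. -/
namespace HatGame

/-- The pairs of colors at positions `t`, `t + 1` of a path that are reached from a pair in `E` at
positions `0`, `1` by assignments in which nobody at positions `1, …, t` guesses correctly. -/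
def chainRel (F : ℕ → ℕ → ℕ → ℕ) (H : ℕ → ℕ) (E : ℕ → ℕ → Prop) : ℕ → ℕ → ℕ → Prop
  | 0 => E
  | t + 1 => fun z u => u < H (t + 2) ∧ ∃ y, chainRel F H E t y z ∧ F (t + 1) y u ≠ z

section Chain

variable {F : ℕ → ℕ → ℕ → ℕ} {H : ℕ → ℕ} {E : ℕ → ℕ → Prop}

lemma chainRel.exists_path {t y z : ℕ} (hR : chainRel F H E t y z) :
    ∃ x : ℕ → ℕ, E (x 0) (x 1) ∧ x t = y ∧ x (t + 1) = z ∧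
      (∀ j < t, F (j + 1) (x j) (x (j + 2)) ≠ x (j + 1)) ∧ ∀ j < t, x (j + 2) < H (j + 2) := by
  induction t generalizing y z with
  | zero => exact ⟨fun j => if j = 0 then y else z, by simpa [chainRel] using hR, by simp,
      by simp, by simp, by simp⟩
  | succ t ih =>
    obtain ⟨hu, w, hw, hF⟩ := hR
    obtain ⟨x, hE, h1, h2, h3, h4⟩ := ih hw
    refine ⟨fun j => if j = t + 2 then z else x j, ?_, ?_, ?_, ?_, ?_⟩
    · simpa using hE
    · simpa using h2
    · simp
    · intro j hj
      rcases Nat.lt_succ_iff_lt_or_eq.1 hj with hj | rfl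
      · have := h3 j hj
        grind
      · grind
    · intro j hj
      rcases Nat.lt_succ_iff_lt_or_eq.1 hj with hj | rfl
      · have := h4 j hj
        grind
      · simpa using hu

lemma chainRel.common_left
    (hE : ∀ z < H 1, ∀ z' < H 1, z ≠ z' → ∃ y, E y z ∧ E y z') (t : ℕ)
    (hH : ∀ j < t, H (j + 1) = 3) :
    ∀ z < H (t + 1), ∀ z' < H (t + 1), z ≠ z' →
      ∃ y, chainRel F H E t y z ∧ chainRel F H E t y z' := by
  induction t with
  | zero => exact hE
  | succ t ih =>
    have ih := ih fun j hj => hH j (by omega)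
    rw [hH t (by omega)] at ih
    have key : ∀ u < H (t + 2), ∀ z < 3, ∀ z' < 3, z ≠ z' →
        chainRel F H E (t + 1) z u ∨ chainRel F H E (t + 1) z' u := by
      intro u hu z hz z' hz' hne
      obtain ⟨y, h1, h2⟩ := ih z hz z' hz' hne
      by_cases h : F (t + 1) y u = z
      · exact Or.inr ⟨hu, y, h2, h ▸ hne⟩
      · exact Or.inl ⟨hu, y, h1, h⟩
    intro u hu u' hu' _
    have a1 := key u hu 0 (by omega) 1 (by omega) (by omega)
    have a2 := key u hu 0 (by omega) 2 (by omega) (by omega)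
    have a3 := key u hu 1 (by omega) 2 (by omega) (by omega)
    have b1 := key u' hu' 0 (by omega) 1 (by omega) (by omega)
    have b2 := key u' hu' 0 (by omega) 2 (by omega) (by omega)
    have b3 := key u' hu' 1 (by omega) 2 (by omega) (by omega)
    by_contra! hc
    have c0 := hc 0
    have c1 := hc 1
    have c2 := hc 2
    tauto

lemma chainRel.cover {t y z z' : ℕ} (hz : chainRel F H E t y z) (hz' : chainRel F H E t y z')
    (hne : z ≠ z') : ∀ u < H (t + 2),
      chainRel F H E (t + 1) z u ∨ chainRel F H E (t + 1) z' u := by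
  intro u hu
  by_cases h : F (t + 1) y u = z
  · exact Or.inr ⟨hu, y, hz', h ▸ hne⟩
  · exact Or.inl ⟨hu, y, hz, h⟩

lemma chainRel.fork (hE : ∃ y z z', z ≠ z' ∧ E y z ∧ E y z') (t : ℕ)
    (hH : ∀ j < t, H (j + 2) = 3) :
    ∃ y z z', z ≠ z' ∧ chainRel F H E t y z ∧ chainRel F H E t y z' := by
  induction t with
  | zero => exact hE
  | succ t ih =>
    obtain ⟨y, z, z', hne, h1, h2⟩ := ih fun j hj => hH j (by omega)
    have key := chainRel.cover h1 h2 hne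
    rw [hH t (by omega)] at key
    have a0 := key 0 (by omega)
    have a1 := key 1 (by omega)
    have a2 := key 2 (by omega)
    rcases a0 with a0 | a0 <;> rcases a1 with a1 | a1 <;> rcases a2 with a2 | a2 <;>
      first
        | exact ⟨_, 0, 1, by omega, a0, a1⟩
        | exact ⟨_, 0, 2, by omega, a0, a2⟩
        | exact ⟨_, 1, 2, by omega, a1, a2⟩

/-- The players of a cycle on positions `0, …, k + 3` win with the guessing functions `F`. -/
def CycleWins (F : ℕ → ℕ → ℕ → ℕ) (H : ℕ → ℕ) (k : ℕ) : Prop :=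
  ∀ x : ℕ → ℕ, (∀ j < k + 4, x j < H j) →
    F 0 (x (k + 3)) (x 1) = x 0 ∨ (∃ j < k + 2, F (j + 1) (x j) (x (j + 2)) = x (j + 1)) ∨
      F (k + 3) (x (k + 2)) (x 0) = x (k + 3)

lemma CycleWins.guess_eq {k a β w c : ℕ} (hw : CycleWins F H k)
    (hE : ∀ v w, E v w → v < H 0 ∧ w < H 1 ∧ F 0 a w ≠ v ∧ F (k + 3) β v ≠ a)
    (ha : a < H (k + 3)) (hβ : β < H (k + 2)) (hR : chainRel F H E k w c)
    (hb : F (k + 2) c a ≠ β) : F (k + 1) w β = c := by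
  obtain ⟨x, hx, hxk, hxk1, hF, hH⟩ := hR.exists_path
  obtain ⟨h0, h1, hv, ha'⟩ := hE _ _ hx
  by_contra hc
  have := hw (fun j => if j ≤ k + 1 then x j else if j = k + 2 then β else a) (by
    intro j hj
    rcases Nat.lt_or_ge j (k + 2) with h | h
    · rw [if_pos (by omega)]
      rcases j with _ | _ | j
      · exact h0
      · exact h1
      · exact hH j (by omega)
    · rw [if_neg (by omega)]
      obtain rfl | rfl : j = k + 2 ∨ j = k + 3 := by omega
      · simpa using hβ
      · simpa using ha)
  rcases this with h | ⟨j, hj, h⟩ | h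
  · simp at h
    exact hv h
  · rcases Nat.lt_or_ge j k with h' | h'
    · rw [if_pos (by omega), if_pos (by omega), if_pos (by omega)] at h
      exact hF j h' h
    · obtain rfl | rfl : j = k ∨ j = k + 1 := by omega
      · simp at h
        grind
      · simp at h
        grind
  · simp at h
    exact ha' h

end Chain

lemma exists_majority (f : Fin 3 → Bool) : ∃ m β β', β ≠ β' ∧ f β = m ∧ f β' = m := by
  revert f; decide

lemma sum_card_fibers {m n : ℕ} (f : Fin m → Fin n) :
    ∑ v, (Finset.univ.filter fun w => f w = v).card = m := by
  have := Finset.card_eq_sum_card_fiberwise (f := f) (s := Finset.univ) (t := Finset.univ)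
    (fun _ _ => Finset.mem_univ _)
  simpa using this.symm

/-- Abstract form of the losing argument when there is at least one vertex outside the four
special ones: `bad a v` counts the colors next to `v` that make `v` guess correctly when its other
neighbor has color `a`, and `num a β` counts the colors making `b` guess `β`. -/
lemma counting_contradiction (g : Fin 4 → Fin 3 → Bool) (bad : Bool → Fin 4 → ℕ)
    (num : Bool → Fin 3 → ℕ) (hbad : ∀ a, ∑ v, bad a v = 3) (hnum : ∀ a, ∑ β, num a β = 4)
    (h0 : ∀ a v β, bad a v = 0 → g v β = a → 3 ≤ num a β)
    (h1 : ∀ a v β, bad a v ≤ 1 → g v β = a → 2 ≤ num a β)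
    (h3 : ∀ a v' β, (∀ v, v ≠ v' → g v β = a) → 3 ≤ num a β) : False := by
  have sum_pair : ∀ a β β', β ≠ β' → num a β + num a β' ≤ 4 := by
    intro a β β' hne
    have := hnum a
    rw [Fin.sum_univ_three] at this
    fin_cases β <;> fin_cases β' <;> simp at hne ⊢ <;> omega
  have pos : ∀ a v β β', β ≠ β' → g v β = a → g v β' = a → 1 ≤ bad a v := by
    intro a v β β' hne hβ hβ'
    by_contra hlt
    have := h0 a v β (by omega) hβ
    have := h0 a v β' (by omega) hβ'
    have := sum_pair a β β' hne
    omega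
  have full : ∀ a v, (∀ β, g v β = a) → 2 ≤ bad a v := by
    intro a v h
    by_contra hlt
    have := h1 a v 0 (by omega) (h 0)
    have := h1 a v 1 (by omega) (h 1)
    have := h1 a v 2 (by omega) (h 2)
    have := hnum a
    rw [Fin.sum_univ_three] at this
    omega
  have tight : ∀ a v β β', β ≠ β' → g v β = a → g v β' = a → bad a v = 1 →
      ∀ v', bad a v' = 0 → ∀ γ, g v' γ = !a := by
    intro a v β β' hne hβ hβ' hb v' hv' γ
    by_contra hγ
    have e0 := h0 a v' γ hv' (by cases a <;> simpa using hγ)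
    have e1 := h1 a v β (by omega) hβ
    have e2 := h1 a v β' (by omega) hβ'
    have := sum_pair a β β' hne
    have := sum_pair a γ β
    have := sum_pair a γ β'
    grind
  by_cases hex : ∃ a v β β', β ≠ β' ∧ g v β = a ∧ g v β' = a ∧ bad a v = 1
  · obtain ⟨a, v, β, β', hne, hβ, hβ', hb⟩ := hex
    obtain ⟨v', hv'⟩ : ∃ v', bad a v' = 0 := by
      by_contra! hc
      have := Finset.sum_le_sum (s := Finset.univ) (f := fun _ : Fin 4 => 1) (g := bad a)
        (fun i _ => Nat.one_le_iff_ne_zero.2 (hc i))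
      rw [hbad a] at this
      simp at this
    have hv'2 := full (!a) v' (tight a v β β' hne hβ hβ' hb v' hv')
    have hmaj : ∀ u, u ≠ v' → ∃ γ γ', γ ≠ γ' ∧ g u γ = a ∧ g u γ' = a := by
      intro u hu
      obtain ⟨m, γ, γ', hγ, e1, e2⟩ := exists_majority (g u)
      by_cases hm : m = a
      · exact ⟨γ, γ', hγ, hm ▸ e1, hm ▸ e2⟩
      · exfalso
        obtain rfl : m = !a := by cases m <;> cases a <;> simp_all
        have hu1 := pos _ _ _ _ hγ e1 e2
        have hsum := hbad (!a)
        have hz : ∀ x, x ≠ u → x ≠ v' → bad (!a) x = 0 ∧ bad (!a) u = 1 := by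
          intro x hx hx'
          have := Finset.sum_le_sum_of_subset (f := bad (!a)) (Finset.subset_univ {x, u, v'})
          rw [Finset.sum_insert (by simp [hx, hx']), Finset.sum_pair hu, hsum] at this
          omega
        obtain ⟨x, y, hxy, hxu, hxv, hyu, hyv⟩ :
            ∃ x y : Fin 4, x ≠ y ∧ x ≠ u ∧ x ≠ v' ∧ y ≠ u ∧ y ≠ v' := by
          clear * -
          revert u v'; decide
        obtain ⟨hx0, hu1⟩ := hz x hxu hxv
        have hy0 := (hz y hyu hyv).1
        have hx2 := full a x (by simpa using tight _ _ _ _ hγ e1 e2 hu1 x hx0)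
        have hy2 := full a y (by simpa using tight _ _ _ _ hγ e1 e2 hu1 y hy0)
        have := Finset.sum_le_sum_of_subset (f := bad a) (Finset.subset_univ {x, y})
        rw [Finset.sum_pair hxy, hbad a] at this
        omega
    have hone : ∀ u, u ≠ v' → bad a u ≤ 1 := by
      intro u hu
      obtain ⟨x, y, hxy, hxu, hxv, hyu, hyv⟩ :
          ∃ x y : Fin 4, x ≠ y ∧ x ≠ u ∧ x ≠ v' ∧ y ≠ u ∧ y ≠ v' := by
        clear * -
        revert u v'; decide
      obtain ⟨_, _, hx, hx1, hx2⟩ := hmaj x hxv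
      obtain ⟨_, _, hy, hy1, hy2⟩ := hmaj y hyv
      have := pos _ _ _ _ hx hx1 hx2
      have := pos _ _ _ _ hy hy1 hy2
      have := Finset.sum_le_sum_of_subset (f := bad a) (Finset.subset_univ {x, y, u})
      rw [Finset.sum_insert (by simp [hxy, hxu]), Finset.sum_pair hyu, hbad a] at this
      omega
    have e1 := h1 a v β (by omega) hβ
    have e2 := h1 a v β' (by omega) hβ'
    have hall : ∀ u, u ≠ v' → g u β = a := by
      intro u hu
      obtain ⟨γ, γ', hγ, d1, d2⟩ := hmaj u hu
      have f1 := h1 a u γ (hone u hu) d1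
      have f2 := h1 a u γ' (hone u hu) d2
      have := hnum a
      rw [Fin.sum_univ_three] at this
      by_contra hc
      have hd1 : γ ≠ β := fun h => hc (h ▸ d1)
      have hd2 : γ' ≠ β := fun h => hc (h ▸ d2)
      clear * - f1 f2 e1 hd1 hd2 hγ this
      fin_cases γ <;> fin_cases γ' <;> fin_cases β <;> simp at * <;> omega
    have := h3 a v' β hall
    have := sum_pair a β β' hne
    omega
  · have h2 : ∀ v, 2 ≤ bad true v + bad false v := by
      intro v
      obtain ⟨m, γ, γ', hγ, e1, e2⟩ := exists_majority (g v)
      have p := pos _ _ _ _ hγ e1 e2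
      have : bad m v ≠ 1 := fun h => hex ⟨m, v, γ, γ', hγ, e1, e2, h⟩
      cases m <;> omega
    have := Finset.sum_le_sum (s := Finset.univ) (f := fun _ : Fin 4 => 2)
      (g := fun v => bad true v + bad false v) (fun i _ => h2 i)
    rw [Finset.sum_add_distrib, hbad, hbad] at this
    simp at this

/-- Abstract form of the losing argument for the cycle consisting of the four special vertices. -/
lemma four_cycle_contradiction (g : Fin 4 → Fin 3 → Bool) (fv : Bool → Fin 4 → Fin 4)
    (fb : Bool → Fin 4 → Fin 3)
    (h : ∀ v β c c', c ≠ c' → fv (g v β) c ≠ v → fv (g v β) c' ≠ v →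
      fb (g v β) c = β ∨ fb (g v β) c' = β) : False := by
  let bad : Bool → Fin 4 → ℕ := fun a v => (Finset.univ.filter fun c => fv a c = v).card
  have hbad : ∀ a, ∑ v, bad a v = 4 := fun a => sum_card_fibers _
  choose m p q hpq hp hq using fun v => exists_majority (g v)
  have hgood : ∀ a v, bad a v + (Finset.univ.filter fun c => fv a c ≠ v).card = 4 := by
    intro a v
    simpa using Finset.card_filter_add_card_filter_not (s := Finset.univ) fun c => fv a c = v
  have hm : ∀ v, 2 ≤ bad (m v) v := by
    intro v
    by_contra hlt
    have := hgood (m v) v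
    obtain ⟨x, y, z, hx, hy, hz, hxy, hxz, hyz⟩ := (Finset.two_lt_card_iff
      (s := Finset.univ.filter fun c => fv (m v) c ≠ v)).1 (by omega)
    simp only [Finset.mem_filter, Finset.mem_univ, true_and] at hx hy hz
    have hp' := h v (p v)
    have hq' := h v (q v)
    rw [hp] at hp'
    rw [hq] at hq'
    have := hp' x y hxy hx hy
    have := hp' x z hxz hx hz
    have := hp' y z hyz hy hz
    have := hq' x y hxy hx hy
    have := hq' x z hxz hx hz
    have := hq' y z hyz hy hz
    have := hpq v
    grind
  have hexact : ∀ v, bad (m v) v = 2 ∧ bad (!m v) v = 0 := by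
    have h2 : ∀ v, bad true v + bad false v = bad (m v) v + bad (!m v) v := by
      intro v
      cases m v <;> simp [add_comm]
    have e := Finset.sum_congr rfl fun v (_ : v ∈ Finset.univ) => h2 v
    rw [Finset.sum_add_distrib, hbad, hbad, Fin.sum_univ_four] at e
    have := hm 0
    have := hm 1
    have := hm 2
    have := hm 3
    intro v
    fin_cases v <;> simp <;> omega
  obtain ⟨x, hx⟩ : ∃ x, m x = true := by
    by_contra! hc
    have : ∀ v, bad true v = 0 := fun v => by
      have := (hexact v).2
      have := hc v
      simp_all
    simpa [this] using hbad true
  obtain ⟨y, hy⟩ : ∃ y, m y = false := by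
    by_contra! hc
    have : ∀ v, bad false v = 0 := fun v => by
      have := (hexact v).2
      have := hc v
      simp_all
    simpa [this] using hbad false
  have hy0 : ∀ c, fv true c ≠ y := by
    have := (hexact y).2
    rw [hy] at this
    simpa [bad, Finset.filter_eq_empty_iff] using this
  obtain ⟨β₀, hβ₀⟩ : ∃ β, g y β = true := by
    by_contra! hc
    have hc : ∀ β, g y β = false := by simpa using hc
    have := hgood false y
    have hyy := (hexact y).1
    rw [hy] at hyy
    obtain ⟨c, c', hcm, hcm', hne⟩ := (Finset.one_lt_card_iff
      (s := Finset.univ.filter fun c => fv false c ≠ y)).1 (by omega)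
    simp only [Finset.mem_filter, Finset.mem_univ, true_and] at hcm hcm'
    have hh := fun β => h y β c c' hne
    simp only [hc] at hh
    have a0 := hh 0 hcm hcm'
    have a1 := hh 1 hcm hcm'
    have a2 := hh 2 hcm hcm'
    grind
  have huniq : ∀ c c', fb true c ≠ β₀ → fb true c' ≠ β₀ → c = c' := by
    intro c c' h1 h2
    by_contra hne
    have := h y β₀ c c' hne
    rw [hβ₀] at this
    rcases this (hy0 c) (hy0 c') with h | h
    · exact h1 h
    · exact h2 h
  have hfree : ∀ v, m v = true → ∃ c, fb true c ≠ β₀ ∧ fv true c ≠ v := by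
    intro v hv
    have := hgood true v
    have hvv := (hexact v).1
    rw [hv] at hvv
    obtain ⟨c, c', hcm, hcm', hne⟩ := (Finset.one_lt_card_iff
      (s := Finset.univ.filter fun c => fv true c ≠ v)).1 (by omega)
    simp only [Finset.mem_filter, Finset.mem_univ, true_and] at hcm hcm'
    have hp' := h v (p v) c c' hne
    have hq' := h v (q v) c c' hne
    rw [hp, hv] at hp'
    rw [hq, hv] at hq'
    have := hp' hcm hcm'
    have := hq' hcm hcm'
    have := hpq v
    by_cases h1 : fb true c = β₀
    · exact ⟨c', by grind, hcm'⟩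
    · exact ⟨c, h1, hcm⟩
  obtain ⟨c₀, hc₀, -⟩ := hfree x hx
  have hmv : m (fv true c₀) = true := by
    by_contra hc
    have := (hexact (fv true c₀)).2
    have hc : m (fv true c₀) = false := by simpa using hc
    rw [hc] at this
    simp only [Bool.not_false, bad, Finset.card_eq_zero, Finset.filter_eq_empty_iff] at this
    exact this (Finset.mem_univ c₀) rfl
  obtain ⟨c, hc, hcv⟩ := hfree _ hmv
  exact hcv (by rw [huniq c c₀ hc hc₀])

lemma not_cycleWins_of_pos {F : ℕ → ℕ → ℕ → ℕ} {H : ℕ → ℕ} {k : ℕ} (hk : 0 < k) (hv : H 0 = 4)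
    (hw : ∀ j < k, H (j + 1) = 3) (hc : H (k + 1) = 4) (hb : H (k + 2) = 3)
    (ha : H (k + 3) = 2) : ¬ CycleWins F H k := by
  intro win
  let g : Fin 4 → Fin 3 → Bool := fun v β => decide (F (k + 3) β v = 0)
  have hg : ∀ (v : Fin 4) (β : Fin 3), F (k + 3) β v ≠ (g v β).toNat := by
    intro v β
    by_cases h : F (k + 3) β v = 0 <;> simp [g, h]
  let fv : Bool → Fin 3 → Fin 4 := fun a w => Fin.ofNat 4 (F 0 a.toNat w)
  let fb : Bool → Fin 4 → Fin 3 := fun a c => Fin.ofNat 3 (F (k + 2) c a.toNat)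
  have hat : ∀ a : Bool, a.toNat < H (k + 3) := fun a => by rw [ha]; exact a.toNat_lt
  have hH1 : H 1 = 3 := hw 0 hk
  have hfv : ∀ a w (v : Fin 4), fv a w ≠ v → F 0 a.toNat w ≠ v := by
    intro a w v h e
    exact h (by simp [fv, e])
  have hfb : ∀ a c (β : Fin 3), fb a c ≠ β → F (k + 2) c a.toNat ≠ β := by
    intro a c β h e
    exact h (by simp [fb, e])
  have two : ∀ a β (E : Fin 4 → Fin 3 → Prop), (∀ v w, E v w → g v β = a ∧ fv a w ≠ v) →
      (∀ w w', w ≠ w' → ∃ v, E v w ∧ E v w') →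
      3 ≤ (Finset.univ.filter fun c => fb a c = β).card := by
    intro a β E hE hcom
    have hlow : (Finset.univ.filter fun c => ¬ fb a c = β).card ≤ 1 := by
      rw [Finset.card_le_one]
      simp only [Finset.mem_filter, Finset.mem_univ, true_and]
      intro c h1 c' h2
      by_contra hne
      let E' : ℕ → ℕ → Prop := fun v w => ∃ (v' : Fin 4) (w' : Fin 3), E v' w' ∧ v = v' ∧ w = w'
      have hE' : ∀ v w, E' v w → v < H 0 ∧ w < H 1 ∧ F 0 a.toNat w ≠ v ∧
          F (k + 3) β v ≠ a.toNat := by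
        rintro _ _ ⟨v, w, hvw, rfl, rfl⟩
        obtain ⟨e1, e2⟩ := hE v w hvw
        exact ⟨by omega, by omega, hfv _ _ _ e2, e1 ▸ hg v β⟩
      obtain ⟨y, r1, r2⟩ := chainRel.common_left (F := F) (H := H) (E := E') (by
        intro z hz z' hz' hzz
        obtain ⟨v, e1, e2⟩ := hcom ⟨z, by omega⟩ ⟨z', by omega⟩ (by simpa using hzz)
        exact ⟨v, ⟨v, _, e1, rfl, rfl⟩, ⟨v, _, e2, rfl, rfl⟩⟩) k hw c (by omega) c' (by omega)
        (by simpa [Fin.ext_iff] using hne)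
      have s1 := win.guess_eq hE' (hat a) (by omega) r1 (hfb _ _ _ h1)
      have s2 := win.guess_eq hE' (hat a) (by omega) r2 (hfb _ _ _ h2)
      exact hne (Fin.ext (s1.symm.trans s2))
    have := Finset.card_filter_add_card_filter_not (s := Finset.univ) fun c => fb a c = β
    rw [Finset.card_univ, Fintype.card_fin] at this
    omega
  refine counting_contradiction g (fun a v => (Finset.univ.filter fun w => fv a w = v).card)
    (fun a β => (Finset.univ.filter fun c => fb a c = β).card) (fun a => sum_card_fibers _)
    (fun a => sum_card_fibers _) ?_ ?_ ?_
  · intro a v β hbad hgv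
    refine two a β (fun v' w => v' = v) ?_ fun w w' _ => ⟨v, rfl, rfl⟩
    rintro _ w rfl
    simp only [Finset.card_eq_zero, Finset.filter_eq_empty_iff] at hbad
    exact ⟨hgv, hbad (Finset.mem_univ w)⟩
  · intro a v β hbad hgv
    have hsum := Finset.card_filter_add_card_filter_not (s := Finset.univ) fun w => fv a w = v
    rw [Finset.card_univ, Fintype.card_fin] at hsum
    obtain ⟨w, w', hmw, hmw', hne⟩ := (Finset.one_lt_card_iff
      (s := Finset.univ.filter fun w => ¬ fv a w = v)).1 (by omega)
    simp only [Finset.mem_filter, Finset.mem_univ, true_and] at hmw hmw'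
    let E : ℕ → ℕ → Prop := fun v' w'' => v' = v ∧ (w'' = w ∨ w'' = w')
    have hE : ∀ v w, E v w → v < H 0 ∧ w < H 1 ∧ F 0 a.toNat w ≠ v ∧
        F (k + 3) β v ≠ a.toNat := by
      rintro _ _ ⟨rfl, rfl | rfl⟩
      · exact ⟨by omega, by omega, hfv _ _ _ hmw, hgv ▸ hg v β⟩
      · exact ⟨by omega, by omega, hfv _ _ _ hmw', hgv ▸ hg v β⟩
    obtain ⟨t, rfl⟩ : ∃ t, k = t + 1 := ⟨k - 1, by omega⟩
    obtain ⟨y, z, z', hzz, r1, r2⟩ := chainRel.fork (F := F) (H := H) (E := E)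
      ⟨v, w, w', by simpa [Fin.ext_iff] using hne, ⟨rfl, Or.inl rfl⟩, ⟨rfl, Or.inr rfl⟩⟩ t
      (fun j hj => hw (j + 1) (by omega))
    have cov := chainRel.cover r1 r2 hzz
    replace hc : H (t + 2) = 4 := hc
    have hlow : (Finset.univ.filter fun c => ¬ fb a c = β) ⊆
        {Fin.ofNat 4 (F (t + 2) z β), Fin.ofNat 4 (F (t + 2) z' β)} := by
      intro c hcm
      simp only [Finset.mem_filter, Finset.mem_univ, true_and] at hcm
      rw [Finset.mem_insert, Finset.mem_singleton]
      rcases cov c (by omega) with r | r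
      · left
        have s := win.guess_eq hE (hat a) (by omega) r (hfb _ _ _ hcm)
        simp [s]
      · right
        have s := win.guess_eq hE (hat a) (by omega) r (hfb _ _ _ hcm)
        simp [s]
    have hle := (Finset.card_le_card hlow).trans Finset.card_le_two
    have := Finset.card_filter_add_card_filter_not (s := Finset.univ) fun c => fb a c = β
    rw [Finset.card_univ, Fintype.card_fin] at this
    omega
  · intro a v' β hgv
    refine two a β (fun v w => v ≠ v' ∧ fv a w ≠ v) (fun v w h => ⟨hgv v h.1, h.2⟩) ?_
    intro w w' _
    have : ∀ p q r : Fin 4, ∃ v, (v ≠ p ∧ q ≠ v) ∧ v ≠ p ∧ r ≠ v := by decide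
    exact this _ _ _

lemma not_cycleWins_zero {F : ℕ → ℕ → ℕ → ℕ} {H : ℕ → ℕ} (hv : H 0 = 4) (hc : H 1 = 4)
    (hb : H 2 = 3) (ha : H 3 = 2) : ¬ CycleWins F H 0 := by
  intro win
  have hb' : H (0 + 2) = 3 := hb
  let g : Fin 4 → Fin 3 → Bool := fun v β => decide (F 3 β v = 0)
  have hg : ∀ (v : Fin 4) (β : Fin 3), F 3 β v ≠ (g v β).toNat := by
    intro v β
    by_cases h : F 3 β v = 0 <;> simp [g, h]
  refine four_cycle_contradiction g (fun a c => Fin.ofNat 4 (F 0 a.toNat c))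
    (fun a c => Fin.ofNat 3 (F 2 c a.toNat)) ?_
  intro v β c c' hne h1 h2
  by_contra! hcon
  let E : ℕ → ℕ → Prop := fun v' z => v' = v ∧ (z = c ∨ z = c')
  have hE : ∀ v' w, E v' w → v' < H 0 ∧ w < H 1 ∧ F 0 (g v β).toNat w ≠ v' ∧
      F (0 + 3) β v' ≠ (g v β).toNat := by
    rintro _ _ ⟨rfl, rfl | rfl⟩
    · exact ⟨by omega, by omega, fun e => h1 (by simp [e]), hg v β⟩
    · exact ⟨by omega, by omega, fun e => h2 (by simp [e]), hg v β⟩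
  have hat : (g v β).toNat < H (0 + 3) := by rw [ha]; exact Bool.toNat_lt _
  have s1 := win.guess_eq (w := v) (c := c) hE hat (by omega) ⟨rfl, Or.inl rfl⟩
    (fun e => hcon.1 (by simp at e; simp [e]))
  have s2 := win.guess_eq (w := v) (c := c') hE hat (by omega) ⟨rfl, Or.inr rfl⟩
    (fun e => hcon.2 (by simp at e; simp [e]))
  exact hne (Fin.ext (s1.symm.trans s2))

section Position

open Fin.CommRing

/-- The vertex at distance `j` before `i` on the cycle. -/
def position {k : ℕ} (i : Fin (k + 4)) (j : ℕ) : Fin (k + 4) := i - (j : Fin (k + 4))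

variable {k : ℕ} (i : Fin (k + 4))

lemma position_zero : position i 0 = i := by simp [position]

lemma position_succ_add_one (j : ℕ) : position i (j + 1) + 1 = position i j := by
  simp only [position]; push_cast; ring

lemma position_eq_add (j m : ℕ) (hm : j + m = k + 4) : position i j = i + (m : Fin (k + 4)) := by
  have h : ((j + m : ℕ) : Fin (k + 4)) = 0 := by rw [hm]; simp
  push_cast at h
  simp only [position]
  linear_combination -h

lemma position_add_three : position i (k + 3) = i + 1 := by
  simpa using position_eq_add i (k + 3) 1 rfl

lemma position_add_two : position i (k + 2) = i + 2 := by
  simpa using position_eq_add i (k + 2) 2 rfl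

lemma position_add_one : position i (k + 1) = i + 3 := by
  simpa using position_eq_add i (k + 1) 3 rfl

lemma position_injOn {j j' : ℕ} (hj : j < k + 4) (hj' : j' < k + 4)
    (h : position i j = position i j') : j = j' := by
  have h : (j : Fin (k + 4)) = j' := sub_right_injective h
  have := congrArg Fin.val h
  rwa [Fin.val_natCast, Fin.val_natCast, Nat.mod_eq_of_lt hj, Nat.mod_eq_of_lt hj'] at this

lemma position_val_sub (u : Fin (k + 4)) : position i (i - u).val = u := by
  simp [position]

lemma val_sub_position {j : ℕ} (hj : j < k + 4) : (i - position i j).val = j :=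
  position_injOn i (Fin.is_lt _) hj (position_val_sub i _)

lemma Winning.exists_cycleWins {h : Fin (k + 4) → ℕ} (hpos : ∀ u, 0 < h u)
    (hwin : Winning (SimpleGraph.cycleGraph (k + 4)) h) :
    ∃ F, CycleWins F (fun j => h (position i j)) k := by
  obtain ⟨s, hloc, hs⟩ := hwin
  let col : (Fin (k + 4) → ℕ) → ∀ u, Fin (h u) := fun y u => ⟨y u % h u, Nat.mod_lt _ (hpos u)⟩
  let F : ℕ → ℕ → ℕ → ℕ := fun j p q =>
    (s (position i j) (col fun u => if u = position i j + 1 then p else q)).val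
  refine ⟨F, ?_⟩
  intro x hx
  obtain ⟨v, hsv⟩ := hs (col fun u => x (i - u).val)
  obtain ⟨j, hj, rfl⟩ : ∃ j < k + 4, position i j = v := ⟨_, Fin.is_lt _, position_val_sub i v⟩
  have htwo : ∀ u : Fin (k + 4), u - 1 ≠ u + 1 := by
    intro u e
    have e : (2 : Fin (k + 4)) = 0 := by linear_combination -e
    have := congrArg Fin.val e
    simp [Nat.mod_eq_of_lt] at this
  have key : F j (x (i - (position i j + 1)).val)
      (x (i - (position i j - 1)).val) = x j := by
    have hl := hloc (position i j) (col fun u => x (i - u).val)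
      (col fun u => if u = position i j + 1 then x (i - (position i j + 1)).val
        else x (i - (position i j - 1)).val) (by
        intro u hu
        have hu' : u = position i j + 1 ∨ u = position i j - 1 := by
          rcases SimpleGraph.cycleGraph_adj.1 hu with e | e
          · right; linear_combination -e
          · left; linear_combination e
        rcases hu' with rfl | rfl
        · simp [col]
        · simp [col, htwo])
    have := congrArg Fin.val (hl.symm.trans hsv)
    refine this.trans ?_
    simp only [col, val_sub_position i hj]
    exact Nat.mod_eq_of_lt (hx j hj)
  have hsucc : ∀ j, position i j - 1 = position i (j + 1) := fun j => by
    rw [← position_succ_add_one]; ring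
  have hwrap : position i (k + 2 + 1 + 1) = position i 0 := by
    simp [position]
  rcases j with _ | j
  · left
    have e : position i 0 + 1 = position i (k + 3) := by rw [position_zero, position_add_three]
    rwa [e, hsucc, val_sub_position i (by omega), val_sub_position i (by omega)] at key
  · right
    rw [position_succ_add_one, hsucc, val_sub_position i (by omega)] at key
    rcases Nat.lt_or_ge j (k + 2) with h' | h'
    · left
      rw [val_sub_position i (by omega)] at key
      exact ⟨j, h', key⟩
    · right
      obtain rfl : j = k + 2 := by omega
      rwa [hwrap, val_sub_position i (by omega)] at key

end Position

end HatGame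

/-- A cycle on `n ≥ 4` vertices with four consecutive vertices of hatnesses
`4, 2, 3, 4` and all other vertices of hatness 3 is losing. -/
theorem cycle_4234_losing (n : ℕ) [NeZero n] (hn : 4 ≤ n) (h : Fin n → ℕ)
    (i : Fin n) (hv : h i = 4) (ha : h (i + 1) = 2) (hb : h (i + 2) = 3)
    (hc : h (i + 3) = 4)
    (hother : ∀ x, x ≠ i → x ≠ i + 1 → x ≠ i + 2 → x ≠ i + 3 → h x = 3) :
    ¬ HatGame.Winning (SimpleGraph.cycleGraph n) h := by
  obtain ⟨k, rfl⟩ : ∃ k, n = k + 4 := ⟨n - 4, by omega⟩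
  have h0 : h (HatGame.position i 0) = 4 := by rw [HatGame.position_zero, hv]
  have h1 : h (HatGame.position i (k + 1)) = 4 := by rw [HatGame.position_add_one]; exact hc
  have h2 : h (HatGame.position i (k + 2)) = 3 := by rw [HatGame.position_add_two]; exact hb
  have h3 : h (HatGame.position i (k + 3)) = 2 := by rw [HatGame.position_add_three]; exact ha
  have hother' : ∀ j < k + 4, j ≠ 0 → j ≠ k + 1 → j ≠ k + 2 → j ≠ k + 3 →
      h (HatGame.position i j) = 3 := by
    intro j hj j0 j1 j2 j3
    refine hother _ (fun e => j0 ?_) (fun e => j3 ?_) (fun e => j2 ?_) (fun e => j1 ?_) <;>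
      apply HatGame.position_injOn i hj (by omega)
    · rw [e, HatGame.position_zero]
    · rw [HatGame.position_add_three]; exact e
    · rw [HatGame.position_add_two]; exact e
    · rw [HatGame.position_add_one]; exact e
  have hpos : ∀ u, 0 < h u := by
    intro u
    obtain ⟨j, hj, rfl⟩ : ∃ j < k + 4, HatGame.position i j = u :=
      ⟨_, Fin.is_lt _, HatGame.position_val_sub i u⟩
    by_cases j0 : j = 0
    · subst j0; omega
    by_cases j1 : j = k + 1
    · subst j1; omega
    by_cases j2 : j = k + 2
    · subst j2; omega
    by_cases j3 : j = k + 3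
    · subst j3; omega
    rw [hother' j hj j0 j1 j2 j3]; omega
  intro hwin
  obtain ⟨F, win⟩ := hwin.exists_cycleWins i hpos
  rcases Nat.eq_zero_or_pos k with rfl | hk
  · exact HatGame.not_cycleWins_zero h0 h1 h2 h3 win
  · exact HatGame.not_cycleWins_of_pos hk h0
      (fun j hj => hother' _ (by omega) (by omega) (by omega) (by omega) (by omega)) h1 h2 h3 win
end

section
/- Let C be a cycle on n ≥ 4 vertices and let h be the hatness function assigning hatness 2 to one vertex of C and hatness 5 to every other vertex. Then the game ⟨C,h⟩ is losing. -/
namespace HatGame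

/-- If `L x` has five arguments for each of the two values of `x`, some color is guessed
at most once by both `L 0` and `L 1`. -/
theorem exists_fiber_card_le_one (L : Fin 2 → Fin 5 → Fin 5) :
    ∃ p, ∀ x, (Finset.univ.filter fun d => L x d = p).card ≤ 1 := by
  by_contra! hcon
  have hsum : ∀ x, ∑ p, (Finset.univ.filter fun d => L x d = p).card = 5 := by
    intro x
    have := Finset.card_eq_sum_card_fiberwise (f := L x) (s := Finset.univ)
      (t := Finset.univ) (by simp)
    simpa using this.symm
  have h0 := hsum 0
  have h1 := hsum 1
  simp only [Fin.exists_fin_two] at hcon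
  have g0 := hcon 0
  have g1 := hcon 1
  have g2 := hcon 2
  have g3 := hcon 3
  have g4 := hcon 4
  simp only [Fin.sum_univ_five] at h0 h1
  omega

/-- On a path whose first vertex has a fixed color `p` guessed for at most one color of the
second vertex, for every last color at least three penultimate colors extend to a coloring
where all vertices but the last guess wrongly. -/
theorem exists_penultimate_colors (F : ℕ → Fin 5 → Fin 5 → Fin 5) (L : Fin 5 → Fin 5) (p : Fin 5)
    (hp : (Finset.univ.filter fun d => L d = p).card ≤ 1) (k : ℕ) :
    ∀ e : Fin 5, ∃ S : Finset (Fin 5), 3 ≤ S.card ∧ ∀ d ∈ S, ∃ c : ℕ → Fin 5,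
      c 0 = p ∧ c (k + 1) = d ∧ c (k + 2) = e ∧ L (c 1) ≠ c 0 ∧
      ∀ i < k + 1, F i (c i) (c (i + 2)) ≠ c (i + 1) := by
  induction k with
  | zero =>
    intro e
    refine ⟨((Finset.univ.filter fun d => L d = p)ᶜ).erase (F 0 p e), ?_, ?_⟩
    · have h1 := Finset.card_compl (Finset.univ.filter fun d => L d = p)
      have h2 := Finset.pred_card_le_card_erase (s := (Finset.univ.filter fun d => L d = p)ᶜ)
        (a := F 0 p e)
      simp only [Fintype.card_fin] at h1
      omega
    · intro d hd
      simp only [Finset.mem_erase, Finset.mem_compl, Finset.mem_filter, Finset.mem_univ,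
        true_and] at hd
      refine ⟨fun i => if i = 0 then p else if i = 1 then d else e, by simp, by simp, by simp,
        by simpa using hd.2, ?_⟩
      intro i hi
      obtain rfl : i = 0 := by omega
      simpa using hd.1.symm
  | succ k ih =>
    intro e
    choose S hS hc using ih
    refine ⟨Finset.univ.filter fun d => ∃ b ∈ S d, F (k + 1) b e ≠ d, ?_, ?_⟩
    · have hle : ((Finset.univ.filter fun d => ∃ b ∈ S d, F (k + 1) b e ≠ d)ᶜ).card ≤ 1 := by
        rw [Finset.card_le_one]
        intro d hd d' hd'
        simp only [Finset.mem_compl, Finset.mem_filter, Finset.mem_univ, true_and, not_exists,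
          not_and, not_not] at hd hd'
        by_contra hne
        have hdisj : Disjoint (S d) (S d') := by
          rw [Finset.disjoint_left]
          intro b hb hb'
          exact hne ((hd b hb).symm.trans (hd' b hb'))
        have h1 := Finset.card_union_of_disjoint hdisj
        have h2 := Finset.card_le_univ (S d ∪ S d')
        have h3 := hS d
        have h4 := hS d'
        simp only [Fintype.card_fin] at h2
        omega
      have h1 := Finset.card_compl (Finset.univ.filter fun d => ∃ b ∈ S d, F (k + 1) b e ≠ d)
      simp only [Fintype.card_fin] at h1
      omega
    · intro d hd
      simp only [Finset.mem_filter, Finset.mem_univ, true_and] at hd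
      obtain ⟨b, hb, hF⟩ := hd
      obtain ⟨c, c0, c1, c2, cL, cF⟩ := hc d b hb
      refine ⟨fun i => if i = k + 3 then e else c i, by simpa using c0, by simpa using c2,
        by simp, by simpa using cL, ?_⟩
      intro i hi
      rcases Nat.lt_succ_iff_lt_or_eq.mp hi with hi | rfl
      · have e1 : i ≠ k + 3 := by omega
        have e2 : i + 2 ≠ k + 3 := by omega
        have e3 : i + 1 ≠ k + 3 := by omega
        simpa only [e1, e2, e3, if_false] using cF i hi
      · simpa [c1, c2] using hF

/-- Two end colors of a path can be chosen such that, for both values of the extra color `x`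
seen by the end vertices, they extend to a coloring in which every vertex guesses wrongly. -/
theorem exists_end_colors (k : ℕ) (F : ℕ → Fin 5 → Fin 5 → Fin 5) (L R : Fin 2 → Fin 5 → Fin 5) :
    ∃ p q : Fin 5, ∀ x, ∃ c : ℕ → Fin 5, c 0 = p ∧ c (k + 2) = q ∧ L x (c 1) ≠ c 0 ∧
      (∀ i < k + 1, F i (c i) (c (i + 2)) ≠ c (i + 1)) ∧ R x (c (k + 1)) ≠ c (k + 2) := by
  obtain ⟨p, hp⟩ := exists_fiber_card_le_one L
  obtain ⟨q, hq⟩ := exists_fiber_card_le_one R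
  refine ⟨p, q, fun x => ?_⟩
  obtain ⟨S, hS, hc⟩ := exists_penultimate_colors F (L x) p (hp x) k q
  obtain ⟨d, hd, hdq⟩ := Finset.exists_mem_notMem_of_card_lt_card
    (s := Finset.univ.filter fun d => R x d = q) (t := S) (by have := hq x; omega)
  obtain ⟨c, c0, c1, c2, cL, cF⟩ := hc d hd
  exact ⟨c, c0, c2, cL, cF, by simpa [c1, c2] using hdq⟩

/-- Adjacent vertices of a cycle have consecutive offsets from any base vertex. -/
theorem offset_of_cycleGraph_adj {n : ℕ} [NeZero n] (a v u : Fin n)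
    (h : (SimpleGraph.cycleGraph n).Adj v u) :
    (u - a).val = (v - a).val + 1 ∨ (v - a).val = (u - a).val + 1 ∨
      ((v - a).val = 0 ∧ (u - a).val + 1 = n) ∨ ((u - a).val = 0 ∧ (v - a).val + 1 = n) := by
  have key : ∀ y z : Fin n, (y - z).val = 1 → y.val = z.val + 1 ∨ (y.val = 0 ∧ z.val + 1 = n) := by
    intro y z hyz
    rcases le_or_gt z y with hle | hlt
    · rw [Fin.coe_sub_iff_le.mpr hle] at hyz
      omega
    · rw [Fin.coe_sub_iff_lt.mpr hlt] at hyz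
      omega
  rw [SimpleGraph.cycleGraph_adj'] at h
  rcases h with h | h
  · have := key (v - a) (u - a) (by rwa [sub_sub_sub_cancel_right])
    omega
  · have := key (u - a) (v - a) (by rwa [sub_sub_sub_cancel_right])
    omega

/-- The coloring of a cycle with color `x` at the vertex `a` and color `c i` at the vertex with
offset `i + 1` from `a`. -/
def cycleColoring {n : ℕ} (a : Fin n) (x : Fin 2) (c : ℕ → Fin 5) (u : Fin n) :
    Fin (if u = a then 2 else 5) :=
  if h : u = a then ⟨x.val, by simpa only [h, if_true] using x.isLt⟩ else ⟨(c ((u - a).val - 1)).val, by simp [h]⟩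

theorem cycleColoring_val_of_offset {n : ℕ} [NeZero n] (a : Fin n) (x : Fin 2) (c : ℕ → Fin 5)
    (u : Fin n) :
    (cycleColoring a x c u).val =
      if (u - a).val = 0 then x.val else (c ((u - a).val - 1)).val := by
  have hiff : (u - a).val = 0 ↔ u = a := by
    rw [Fin.val_eq_zero_iff, sub_eq_zero]
  unfold cycleColoring
  split_ifs <;> simp_all

end HatGame

/-- A cycle on `n ≥ 4` vertices with one vertex of hatness 2 and all other
vertices of hatness 5 is losing. -/
theorem cycle_two_five_losing (n : ℕ) [NeZero n] (hn : 4 ≤ n) (a : Fin n) :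
    ¬ HatGame.Winning (SimpleGraph.cycleGraph n)
        (fun x => if x = a then 2 else 5) := by
  rintro ⟨s, hloc, hwin⟩
  obtain ⟨k, rfl⟩ : ∃ k, n = k + 4 := ⟨n - 4, by omega⟩
  let E := HatGame.cycleColoring a
  have hE : ∀ x c u, (E x c u).val =
      if (u - a).val = 0 then x.val else (c ((u - a).val - 1)).val :=
    HatGame.cycleColoring_val_of_offset a
  let g : ℕ → Fin 2 → (ℕ → Fin 5) → Fin 5 := fun t x c =>
    Fin.ofNat 5 (s (a + Fin.ofNat (k + 4) t) (E x c)).val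
  -- a wrong guess of `g` at offset `t` is a wrong guess of the vertex with that offset
  have hg : ∀ v x c x' c', (v - a).val ≠ 0 →
      (∀ u, (SimpleGraph.cycleGraph (k + 4)).Adj v u → (E x c u).val = (E x' c' u).val) →
      g (v - a).val x' c' ≠ c ((v - a).val - 1) → s v (E x c) ≠ E x c v := by
    intro v x c x' c' hv hu hne heq
    apply hne
    have hva : v ≠ a := by
      rintro rfl
      simp at hv
    have hav : a + Fin.ofNat (k + 4) (v - a).val = v := by
      simp
    have h5 : (s v (E x c)).val < 5 := by
      have := (s v (E x c)).isLt
      simpa only [hva, if_false] using this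
    have hs : s v (E x c) = s v (E x' c') := hloc v _ _ fun u hadj => Fin.ext (hu u hadj)
    have hval := congrArg Fin.val heq
    rw [hE, if_neg hv] at hval
    ext
    simp only [g, Fin.val_ofNat]
    rw [hav, ← hs, Nat.mod_eq_of_lt h5, hval]
  obtain ⟨p, q, hpq⟩ := HatGame.exists_end_colors k
    (fun i b e => g (i + 2) 0 fun j => if j = i then b else e)
    (fun x d => g 1 x fun _ => d) (fun x d => g (k + 3) x fun _ => d)
  obtain ⟨x, hx⟩ : ∃ x : Fin 2,
      (s a (E 0 fun j => if j = 0 then p else q)).val ≠ x.val := by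
    by_contra! hcon
    have h0 := hcon 0
    have h1 := hcon 1
    simp_all
  obtain ⟨c, c0, c2, cL, cF, cR⟩ := hpq x
  obtain ⟨v, hv⟩ := hwin (E x c)
  have hlt := (v - a).isLt
  by_cases h0 : (v - a).val = 0
  · obtain rfl : v = a := by
      rwa [Fin.val_eq_zero_iff, sub_eq_zero] at h0
    apply hx
    rw [hloc v _ (E x c), hv, hE, if_pos h0]
    intro u hadj
    have hu := HatGame.offset_of_cycleGraph_adj v v u hadj
    ext
    rw [hE, hE]
    have : (u - v).val = 1 ∨ (u - v).val = k + 3 := by omega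
    rcases this with h | h <;> simp [h, c0, c2]
  by_cases h1 : (v - a).val = 1
  · refine hg v x c x (fun _ => c 1) h0 ?_ (by rw [h1]; exact cL) hv
    intro u hadj
    have hu := HatGame.offset_of_cycleGraph_adj a v u hadj
    rw [hE, hE]
    have : (u - a).val = 0 ∨ (u - a).val = 2 := by omega
    rcases this with h | h <;> simp [h]
  by_cases h2 : (v - a).val = k + 3
  · refine hg v x c x (fun _ => c (k + 1)) h0 ?_ (by rw [h2]; exact cR) hv
    intro u hadj
    have hu := HatGame.offset_of_cycleGraph_adj a v u hadj
    rw [hE, hE]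
    have : (u - a).val = 0 ∨ (u - a).val = k + 2 := by omega
    rcases this with h | h <;> simp [h]
  obtain ⟨i, hi⟩ : ∃ i, (v - a).val = i + 2 := ⟨(v - a).val - 2, by omega⟩
  refine hg v x c 0 (fun j => if j = i then c i else c (i + 2)) h0 ?_
    (by rw [hi]; simpa using cF i (by omega)) hv
  intro u hadj
  have hu := HatGame.offset_of_cycleGraph_adj a v u hadj
  rw [hE, hE]
  have : (u - a).val = i + 1 ∨ (u - a).val = i + 3 := by omega
  rcases this with h | h <;> simp [h]
end

section
/- Let G be a cactus graph containing at least two triangles (cycles of length 3). Then the hat guessing game ⟨G, ★4⟩, in which every vertex has hatness 4, is winning; in particular HG(G) ≥ 4. -/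
/-- `G` contains at least two (distinct) triangles, i.e. two cycles of length 3
with different edge sets. -/
def SimpleGraph.HasTwoTriangles {V : Type*} (G : SimpleGraph V) : Prop :=
  ∃ (v w : V) (c₁ : G.Walk v v) (c₂ : G.Walk w w),
    c₁.IsCycle ∧ c₂.IsCycle ∧ c₁.length = 3 ∧ c₂.length = 3 ∧
    {e | e ∈ c₁.edges} ≠ {e | e ∈ c₂.edges}

/-- `G` contains at least two (distinct) cycles, i.e. two cycles with different
edge sets. -/
def SimpleGraph.HasTwoCycles {V : Type*} (G : SimpleGraph V) : Prop :=
  ∃ (v w : V) (c₁ : G.Walk v v) (c₂ : G.Walk w w),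
    c₁.IsCycle ∧ c₂.IsCycle ∧ {e | e ∈ c₁.edges} ≠ {e | e ∈ c₂.edges}

/-- `G` contains a cycle whose length is 4 or divisible by 3. -/
def SimpleGraph.HasGoodCycle {V : Type*} (G : SimpleGraph V) : Prop :=
  ∃ (v : V) (c : G.Walk v v), c.IsCycle ∧ (c.length = 4 ∨ 3 ∣ c.length)

namespace HatGame

/-- On a finite vertex set, constant hatness larger than the number of vertices
cannot be won. -/
theorem Winning.le_card {V : Type*} [Fintype V] {G : SimpleGraph V} {q : ℕ}
    (hw : Winning G (fun _ => q)) : q ≤ Fintype.card V := by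
  classical
  obtain ⟨s, hs, hc⟩ := hw
  rcases Nat.eq_zero_or_pos q with rfl | hq
  · exact Nat.zero_le _
  obtain ⟨n, hn⟩ : ∃ n, Fintype.card V = n + 1 := by
    obtain ⟨v, -⟩ := hc fun _ => ⟨0, hq⟩
    have : 0 < Fintype.card V := Fintype.card_pos_iff.2 ⟨v⟩
    exact ⟨_, (Nat.succ_pred_eq_of_pos this).symm⟩
  have hcard (v : V) :
      (Finset.univ.filter fun c : V → Fin q => s v c = c v).card ≤ q ^ n := by
    have hrest : Fintype.card ({u : V // u ≠ v} → Fin q) = q ^ n := by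
      rw [Fintype.card_fun, Fintype.card_fin, Fintype.card_subtype_compl,
        Fintype.card_subtype_eq, hn, Nat.add_sub_cancel]
    rw [← hrest, ← Finset.card_univ]
    refine Finset.card_le_card_of_injOn (fun c u => c u) (fun _ _ => Finset.mem_univ _) ?_
    intro c hcv c' hcv' h
    have hne : ∀ u, u ≠ v → c u = c' u := fun u hu => congrFun h ⟨u, hu⟩
    funext u
    by_cases hu : u = v
    · subst hu
      have h1 : s u c = c u := by simpa using hcv
      have h2 : s u c' = c' u := by simpa using hcv'
      rw [← h1, ← h2]
      exact hs u c c' fun w hw => hne w hw.ne'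
    · exact hne u hu
  have hcover : (Finset.univ : Finset (V → Fin q)) ⊆
      Finset.univ.biUnion fun v => Finset.univ.filter fun c : V → Fin q => s v c = c v := by
    intro c _
    obtain ⟨v, hv⟩ := hc c
    simpa using ⟨v, hv⟩
  have hle := (Finset.card_le_card hcover).trans
    (Finset.card_biUnion_le_card_mul _ _ _ fun v _ => hcard v)
  rw [Finset.card_univ, Finset.card_univ, Fintype.card_fun, Fintype.card_fin, hn, pow_succ',
    ← hn] at hle
  exact Nat.le_of_mul_le_mul_right hle (pow_pos hq n)

theorem Winning.le_number {V : Type*} [Fintype V] {G : SimpleGraph V} {q : ℕ}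
    (hw : Winning G (fun _ => q)) : q ≤ number G :=
  le_csSup ⟨Fintype.card V, fun _ h => h.le_card⟩ hw

/-- The first component of a color in `Fin 4` viewed as a pair of bits. -/
def leftBit (c : Fin 4) : Bool := decide (2 ≤ c)

/-- The second component of a color in `Fin 4` viewed as a pair of bits. -/
def rightBit (c : Fin 4) : Bool := decide (c = 1 ∨ c = 3)

/-- The color in `Fin 4` with prescribed bits. -/
def ofBits (l r : Bool) : Fin 4 := (if l then 2 else 0) + (if r then 1 else 0)

theorem ofBits_leftBit_rightBit (c : Fin 4) : ofBits (leftBit c) (rightBit c) = c := by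
  revert c; decide

/-- The guess of the vertex of hatness `2` in the triangle with hatnesses `2, 4, 4`. -/
def apexGuess (a b : Fin 4) : Bool := decide (a + b < 2)

/-- The guess of the first vertex of hatness `4` in the triangle with hatnesses `2, 4, 4`. -/
def firstGuess (x : Bool) (b : Fin 4) : Fin 4 := -(ofBits x false + b)

/-- The guess of the second vertex of hatness `4` in the triangle with hatnesses `2, 4, 4`. -/
def secondGuess (x : Bool) (a : Fin 4) : Fin 4 := 1 - (ofBits x false + a)

/-- The triangle with hatnesses `2, 4, 4` is winning. -/
theorem triangle_guess (x : Bool) (a b : Fin 4) :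
    apexGuess a b = x ∨ firstGuess x b = a ∨ secondGuess x a = b := by
  revert x a b; decide

/-- Two triangles joined by a path `p 0, …, p k` (possibly `k = 0`) win with hatness `4`:
every path vertex splits its color into two bits, one for each of the two blocks at it. -/
theorem winning_four_of_path {V : Type*} {G : SimpleGraph V} (k : ℕ) (p : ℕ → V) (idx : V → ℕ)
    (a₁ a₂ b₁ b₂ : V) (hidx : ∀ i ≤ k, idx (p i) = i)
    (hp : ∀ i < k, G.Adj (p i) (p (i + 1)))
    (ha₁ : G.Adj (p 0) a₁) (ha₂ : G.Adj (p 0) a₂) (ha : G.Adj a₁ a₂)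
    (hb₁ : G.Adj (p k) b₁) (hb₂ : G.Adj (p k) b₂) (hb : G.Adj b₁ b₂)
    (hpa₁ : ∀ i ≤ k, p i ≠ a₁) (hpa₂ : ∀ i ≤ k, p i ≠ a₂)
    (hpb₁ : ∀ i ≤ k, p i ≠ b₁) (hpb₂ : ∀ i ≤ k, p i ≠ b₂)
    (h₁₁ : a₁ ≠ b₁) (h₁₂ : a₁ ≠ b₂) (h₂₁ : a₂ ≠ b₁) (h₂₂ : a₂ ≠ b₂) :
    Winning G (fun _ => 4) := by
  classical
  let l : (V → Fin 4) → ℕ → Bool := fun c i =>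
    if i = 0 then apexGuess (c a₁) (c a₂) else !rightBit (c (p (i - 1)))
  let r : (V → Fin 4) → ℕ → Bool := fun c i =>
    if i = k then apexGuess (c b₁) (c b₂) else leftBit (c (p (i + 1)))
  let s : V → (V → Fin 4) → Fin 4 := fun v c =>
    if v = a₁ then firstGuess (leftBit (c (p 0))) (c a₂)
    else if v = a₂ then secondGuess (leftBit (c (p 0))) (c a₁)
    else if v = b₁ then firstGuess (rightBit (c (p k))) (c b₂)
    else if v = b₂ then secondGuess (rightBit (c (p k))) (c b₁)
    else if idx v ≤ k ∧ p (idx v) = v then ofBits (l c (idx v)) (r c (idx v))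
    else 0
  have hsp (c : V → Fin 4) (i : ℕ) (hi : i ≤ k) : s (p i) c = ofBits (l c i) (r c i) := by
    simp only [s, hpa₁ i hi, hpa₂ i hi, hpb₁ i hi, hpb₂ i hi, hidx i hi, hi, if_false,
      and_self, if_true]
  refine ⟨s, ?_, ?_⟩
  · intro v c c' h
    by_cases e₁ : v = a₁
    · subst e₁; simp only [s, if_true, h _ ha₁.symm, h _ ha]
    by_cases e₂ : v = a₂
    · subst e₂; simp only [s, e₁, if_false, if_true, h _ ha₂.symm, h _ ha.symm]
    by_cases e₃ : v = b₁
    · subst e₃; simp only [s, e₁, e₂, if_false, if_true, h _ hb₁.symm, h _ hb]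
    by_cases e₄ : v = b₂
    · subst e₄; simp only [s, e₁, e₂, e₃, if_false, if_true, h _ hb₂.symm, h _ hb.symm]
    by_cases e₅ : idx v ≤ k ∧ p (idx v) = v
    · obtain ⟨hi, hv⟩ := e₅
      generalize idx v = i at hi hv
      subst hv
      rw [hsp c i hi, hsp c' i hi]
      have hl : l c i = l c' i := by
        by_cases h0 : i = 0
        · subst h0; simp only [l, if_true, h _ ha₁, h _ ha₂]
        · have hadj := hp (i - 1) (by omega)
          rw [Nat.sub_add_cancel (by omega)] at hadj
          simp only [l, h0, if_false, h _ hadj.symm]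
      have hr : r c i = r c' i := by
        by_cases h0 : i = k
        · subst h0; simp only [r, if_true, h _ hb₁, h _ hb₂]
        · simp only [r, h0, if_false, h _ (hp i (by omega))]
      rw [hl, hr]
    · simp only [s, e₁, e₂, e₃, e₄, e₅, if_false]
  · intro c
    by_contra! hlose
    have hl : ∀ i ≤ k, l c i = leftBit (c (p i)) := by
      intro i
      induction i with
      | zero =>
        intro _
        have h1 := hlose a₁
        have h2 := hlose a₂
        simp only [s, if_true, ha.ne', if_false] at h1 h2
        simpa [l, h1, h2] using triangle_guess (leftBit (c (p 0))) (c a₁) (c a₂)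
      | succ i ih =>
        intro hi
        have h1 := hlose (p i)
        rw [hsp c i (by omega), ih (by omega)] at h1
        have hr : r c i ≠ rightBit (c (p i)) := fun h =>
          h1 (by rw [h, ofBits_leftBit_rightBit])
        have hik : i ≠ k := by omega
        simp only [r, hik, if_false] at hr
        simpa [l] using (Bool.eq_not_of_ne hr).symm
    have hr : r c k = rightBit (c (p k)) := by
      have h1 := hlose b₁
      have h2 := hlose b₂
      simp only [s, if_true, h₁₁.symm, h₁₂.symm, h₂₁.symm, h₂₂.symm, hb.ne', if_false] at h1 h2
      simpa [r, h1, h2] using triangle_guess (rightBit (c (p k))) (c b₁) (c b₂)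
    apply hlose (p k)
    rw [hsp c k le_rfl, hl k le_rfl, hr, ofBits_leftBit_rightBit]

end HatGame

/-- Every vertex of a closed walk of length `3` is adjacent to two adjacent vertices of it. -/
theorem SimpleGraph.Walk.exists_adj_of_length_eq_three {V : Type*} {G : SimpleGraph V} {v : V}
    (c : G.Walk v v) (hc : c.length = 3) {x : V} (hx : x ∈ c.support) :
    ∃ a ∈ c.support, ∃ b ∈ c.support, G.Adj x a ∧ G.Adj x b ∧ G.Adj a b := by
  match c, hc with
  | .cons (v := u) h₁ (.cons (v := w) h₂ (.cons h₃ .nil)), _ =>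
    have hx' : x = v ∨ x = u ∨ x = w := by
      simp at hx
      tauto
    rcases hx' with rfl | rfl | rfl
    · exact ⟨u, by simp, w, by simp, h₁, h₃.symm, h₂⟩
    · exact ⟨v, by simp, w, by simp, h₁.symm, h₂, h₃.symm⟩
    · exact ⟨v, by simp, u, by simp, h₃, h₂.symm, h₁⟩

/-- A cactus graph with at least two triangles is winning when every vertex has
hatness 4; in particular its hat guessing number is at least 4. -/
theorem cactus_two_triangles_winning_four {V : Type*} [Fintype V]
    (G : SimpleGraph V) (hG : G.IsCactus) (ht : G.HasTwoTriangles) :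
    HatGame.Winning G (fun _ => 4) ∧ 4 ≤ HatGame.number G := by
  suffices h : HatGame.Winning G (fun _ => 4) from ⟨h, h.le_number⟩
  obtain ⟨hconn, hcyc⟩ := hG
  obtain ⟨v, w, c₁, c₂, hc₁, hc₂, hl₁, hl₂, hne⟩ := ht
  have hsub := hcyc v w c₁ c₂ hc₁ hc₂ hne
  obtain ⟨⟨x, y⟩, ⟨hx, hy⟩, hmin⟩ := Set.exists_min_image
    ({x | x ∈ c₁.support} ×ˢ {x | x ∈ c₂.support}) (fun z : V × V => G.dist z.1 z.2)
    (Set.toFinite _) ⟨(v, w), c₁.start_mem_support, c₂.start_mem_support⟩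
  replace hx : x ∈ c₁.support := hx
  replace hy : y ∈ c₂.support := hy
  replace hmin : ∀ a ∈ c₁.support, ∀ b ∈ c₂.support, G.dist x y ≤ G.dist a b :=
    fun a ha b hb => hmin (a, b) ⟨ha, hb⟩
  obtain ⟨a₁, ha₁, a₂, ha₂, hxa₁, hxa₂, ha⟩ := c₁.exists_adj_of_length_eq_three hl₁ hx
  obtain ⟨b₁, hb₁, b₂, hb₂, hyb₁, hyb₂, hb⟩ := c₂.exists_adj_of_length_eq_three hl₂ hy
  obtain ⟨p, hp⟩ := hconn.exists_walk_length_eq_dist x y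
  have hleft (i : ℕ) : G.dist x (p.getVert i) ≤ i :=
    (SimpleGraph.dist_le (p.take i)).trans (by simp)
  have hright (i : ℕ) : G.dist (p.getVert i) y ≤ p.length - i :=
    (SimpleGraph.dist_le (p.drop i)).trans (by simp)
  have hidx (i : ℕ) (hi : i ≤ p.length) : G.dist x (p.getVert i) = i := by
    have := hconn.dist_triangle (u := x) (v := p.getVert i) (w := y)
    have := hleft i
    have := hright i
    omega
  have hpa (a : V) (hac : a ∈ c₁.support) (hxa : G.Adj x a) (i : ℕ) (hi : i ≤ p.length) :
      p.getVert i ≠ a := by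
    rintro rfl
    have h1 := hmin _ hac _ hy
    have h2 := hright i
    have h3 := hidx i hi
    have h4 := hconn.pos_dist_of_ne hxa.ne
    omega
  have hpb (b : V) (hbc : b ∈ c₂.support) (hyb : G.Adj y b) (i : ℕ) (hi : i ≤ p.length) :
      p.getVert i ≠ b := by
    rintro rfl
    have h1 := hmin _ hx _ hbc
    have h2 := hleft i
    obtain rfl : i = p.length := by omega
    exact hyb.ne p.getVert_length.symm
  have hab (a : V) (hac : a ∈ c₁.support) (hxa : G.Adj x a) (b : V) (hbc : b ∈ c₂.support) :
      a ≠ b := by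
    rintro rfl
    have h1 := hmin _ hac _ hbc
    rw [SimpleGraph.dist_self, Nat.le_zero, hconn.dist_eq_zero_iff] at h1
    subst h1
    exact hxa.ne (hsub ⟨hx, hy⟩ ⟨hac, hbc⟩)
  exact HatGame.winning_four_of_path p.length p.getVert (G.dist x) a₁ a₂ b₁ b₂ hidx
    (fun i hi => p.adj_getVert_succ hi) (by simpa using hxa₁) (by simpa using hxa₂) ha
    (by simpa using hyb₁) (by simpa using hyb₂) hb
    (hpa a₁ ha₁ hxa₁) (hpa a₂ ha₂ hxa₂) (hpb b₁ hb₁ hyb₁) (hpb b₂ hb₂ hyb₂)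
    (hab a₁ ha₁ hxa₁ b₁ hb₁) (hab a₁ ha₁ hxa₁ b₂ hb₂)
    (hab a₂ ha₂ hxa₂ b₁ hb₁) (hab a₂ ha₂ hxa₂ b₂ hb₂)
end

section
/- Let P be a path on n ≥ 2 vertices and let h be the hatness function assigning hatness 2 to both endpoints of P and hatness 3 to every interior vertex. Then the game ⟨P,h⟩ is winning. -/
/-- The guess of vertex `v` on a path with `n` vertices, when the colors are given by `x`. -/
def HatGame.pathGuess (n v : ℕ) (x : ℕ → ℕ) : ℕ :=
  if v = 0 then (if x 1 = 0 then 1 else 0)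
  else if x (v - 1) = (if v - 1 = 0 then 0 else 1) then 0
  else if v = n - 1 then 1
  else if x (v + 1) = 0 then 2 else 1

theorem HatGame.pathGuess_lt (n v : ℕ) (x : ℕ → ℕ) :
    HatGame.pathGuess n v x < if v = 0 ∨ v = n - 1 then 2 else 3 := by
  unfold HatGame.pathGuess
  grind

theorem HatGame.pathGuess_congr {n v : ℕ} (hn : 2 ≤ n) (hv : v < n) {x y : ℕ → ℕ}
    (hprev : 0 < v → x (v - 1) = y (v - 1)) (hnext : v + 1 < n → x (v + 1) = y (v + 1)) :
    HatGame.pathGuess n v x = HatGame.pathGuess n v y := by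
  unfold HatGame.pathGuess
  grind

/-- If the first `i + 1` vertices all guess wrong, whether vertex `i` has its distinguished color
is determined by whether the next vertex has color `0`. -/
theorem HatGame.eq_iff_of_pathGuess_ne {n : ℕ} {x : ℕ → ℕ}
    (hx : ∀ v < n, x v < if v = 0 ∨ v = n - 1 then 2 else 3)
    (hne : ∀ v < n, HatGame.pathGuess n v x ≠ x v) (i : ℕ) (hi : i + 1 < n) :
    x i = (if i = 0 then 0 else 1) ↔ x (i + 1) = 0 := by
  induction i with
  | zero =>
    have h₁ := hx 0 (by omega)
    have h₂ := hne 0 (by omega)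
    unfold HatGame.pathGuess at h₂
    grind
  | succ i ih =>
    have ih := ih (by omega)
    have h₁ := hx (i + 1) (by omega)
    have h₂ := hne (i + 1) (by omega)
    simp only [HatGame.pathGuess, Nat.add_sub_cancel] at h₂
    grind

theorem HatGame.exists_pathGuess_eq {n : ℕ} (hn : 2 ≤ n) {x : ℕ → ℕ}
    (hx : ∀ v < n, x v < if v = 0 ∨ v = n - 1 then 2 else 3) :
    ∃ v < n, HatGame.pathGuess n v x = x v := by
  by_contra! hne
  obtain ⟨m, rfl⟩ := Nat.exists_eq_add_of_le' hn
  have h := HatGame.eq_iff_of_pathGuess_ne hx hne m (by omega)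
  have h₁ := hx (m + 1) (by omega)
  have h₂ := hne (m + 1) (by omega)
  simp only [HatGame.pathGuess, Nat.add_sub_cancel] at h₂
  grind

/-- A path on `n ≥ 2` vertices whose two endpoints have hatness 2 and whose
interior vertices have hatness 3 is winning. -/
theorem path_232_winning (n : ℕ) (hn : 2 ≤ n) :
    HatGame.Winning (SimpleGraph.pathGraph n)
      (fun v => if v.val = 0 ∨ v.val = n - 1 then 2 else 3) := by
  let ext (c : ∀ u : Fin n, Fin (if u.val = 0 ∨ u.val = n - 1 then 2 else 3)) (j : ℕ) : ℕ :=
    if hj : j < n then (c ⟨j, hj⟩).val else 0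
  refine ⟨fun v c => ⟨HatGame.pathGuess n v (ext c), HatGame.pathGuess_lt n v _⟩, ?_, ?_⟩
  · intro v c c' h
    refine Fin.ext (HatGame.pathGuess_congr hn v.isLt ?_ ?_)
    · intro hv
      have hlt : v.val - 1 < n := by omega
      have := h ⟨v.val - 1, hlt⟩
        (SimpleGraph.pathGraph_adj.2 (Or.inr (Nat.sub_add_cancel hv)))
      simp only [ext, dif_pos hlt, this]
    · intro hv
      have := h ⟨v.val + 1, hv⟩ (SimpleGraph.pathGraph_adj.2 (Or.inl rfl))
      simp only [ext, dif_pos hv, this]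
  · intro c
    obtain ⟨v, hv, h⟩ := HatGame.exists_pathGuess_eq hn (x := ext c) (fun v hv => by
      simp only [ext, dif_pos hv]
      exact (c ⟨v, hv⟩).isLt)
    refine ⟨⟨v, hv⟩, Fin.ext ?_⟩
    simpa only [ext, dif_pos hv] using h
end
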